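/- For every integer r with 1 ≤ r ≤ 9, the r-color Ramsey number of the loose 3-uniform path of length three is R(P;r) = r + 6. -/

import Mathlib

/-- `ramseyProp n r` : every coloring of the 3-element subsets of an `n`-element
set with `r` colors yields a monochromatic copy of the loose path `P`, i.e.
seven distinct vertices `a,b,c,d,e,f,g` with `{a,b,c}`, `{c,d,e}`, `{e,f,g}`
all of the same color. -/
def ramseyProp (n r : ℕ) : Prop :=
  ∀ col : Finset (Fin n) → Fin r,
    ∃ a b c d e f g : Fin n,
      List.Pairwise (· ≠ ·) [a, b, c, d, e, f, g] ∧
      col {a, b, c} = col {c, d, e} ∧ col {c, d, e} = col {e, f, g}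

namespace LP
open Finset

variable {α : Type*} [DecidableEq α]

/-- No loose path of length three (set form). -/
def PF (H : Finset (Finset α)) : Prop :=
  ∀ e ∈ H, ∀ f ∈ H, ∀ g ∈ H, (e ∩ f).card = 1 → (f ∩ g).card = 1 → Disjoint e g → False

/-- `H` is a 3-graph on the vertex set `V`. -/
def Tri (V : Finset α) (H : Finset (Finset α)) : Prop :=
  ∀ e ∈ H, e ⊆ V ∧ e.card = 3

/-- All edges but at most one contain a common vertex. -/
def Near (H : Finset (Finset α)) : Prop :=
  ∃ v, (H.filter (fun e => v ∉ e)).card ≤ 1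

def link (H : Finset (Finset α)) (v : α) : Finset (Finset α) :=
  (H.filter (fun e => v ∈ e)).image (fun e => e.erase v)

/-- restriction to a vertex subset -/
def res (H : Finset (Finset α)) (S : Finset α) : Finset (Finset α) :=
  H.filter (fun e => e ⊆ S)

lemma PF.mono {H H' : Finset (Finset α)} (h : PF H) (hs : H' ⊆ H) : PF H' :=
  fun e he f hf g hg => h e (hs he) f (hs hf) g (hs hg)

lemma res_sub (H : Finset (Finset α)) (S : Finset α) : res H S ⊆ H := filter_subset _ _

lemma PF.res {H : Finset (Finset α)} (h : PF H) (S : Finset α) : PF (res H S) :=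
  h.mono (res_sub H S)

lemma Tri.res {V : Finset α} {H : Finset (Finset α)} (h : Tri V H) (S : Finset α) :
    Tri S (res H S) := by
  intro e he
  simp only [LP.res, mem_filter] at he
  exact ⟨he.2, (h e he.1).2⟩

lemma Tri.mono {V : Finset α} {H H' : Finset (Finset α)} (h : Tri V H) (hs : H' ⊆ H) :
    Tri V H' := fun e he => h e (hs he)

lemma mem_link {H : Finset (Finset α)} {v : α} {l : Finset α} :
    l ∈ link H v ↔ v ∉ l ∧ insert v l ∈ H := by
  simp only [link, mem_image, mem_filter]
  constructor
  · rintro ⟨e, ⟨he, hv⟩, rfl⟩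
    exact ⟨notMem_erase _ _, by rwa [insert_erase hv]⟩
  · rintro ⟨hv, h⟩
    exact ⟨insert v l, ⟨h, mem_insert_self _ _⟩, erase_insert hv⟩

lemma card_link (H : Finset (Finset α)) (v : α) :
    (link H v).card = (H.filter (fun e => v ∈ e)).card := by
  apply card_image_of_injOn
  intro e he f hf h
  simp only [coe_filter, Set.mem_setOf_eq] at he hf
  simp only at h
  rw [← insert_erase he.2, h, insert_erase hf.2]

lemma card_split (H : Finset (Finset α)) (v : α) :
    H.card = (link H v).card + (H.filter (fun e => v ∉ e)).card := by
  rw [card_link, card_filter_add_card_filter_not]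

lemma link_sub {V : Finset α} {H : Finset (Finset α)} (h : Tri V H) (v : α) :
    link H v ⊆ powersetCard 2 (V.erase v) := by
  intro l hl
  rw [mem_link] at hl
  obtain ⟨h1, h2⟩ := h _ hl.2
  rw [card_insert_of_notMem hl.1] at h2
  rw [mem_powersetCard]
  refine ⟨fun x hx => mem_erase.2 ⟨fun hh => hl.1 (hh ▸ hx), h1 (mem_insert_of_mem hx)⟩, by omega⟩

lemma card_link_le {V : Finset α} {H : Finset (Finset α)} (h : Tri V H) (v : α) :
    (link H v).card ≤ (V.card - 1).choose 2 := by
  by_cases hv : v ∈ V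
  · have := card_le_card (link_sub h v)
    rwa [card_powersetCard, card_erase_of_mem hv] at this
  · have : link H v = ∅ := by
      rw [eq_empty_iff_forall_notMem]
      intro l hl
      rw [mem_link] at hl
      exact hv ((h _ hl.2).1 (mem_insert_self _ _))
    simp [this]

lemma near_card {V : Finset α} {H : Finset (Finset α)} (h : Tri V H) (hn : Near H) :
    H.card ≤ (V.card - 1).choose 2 + 1 := by
  obtain ⟨v, hv⟩ := hn
  rw [card_split H v]
  have := card_link_le h v
  omega

/-- key star fact -/
lemma PF.star {H : Finset (Finset α)} (h : PF H) {v : α} {g l m : Finset α} (hg : g ∈ H)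
    (hvg : v ∉ g) (hl : l ∈ link H v) (hm : m ∈ link H v) (h1 : (g ∩ l).card = 1)
    (hd : Disjoint m g) (hd2 : Disjoint m l) : False := by
  rw [mem_link] at hl hm
  refine h g hg _ hl.2 _ hm.2 ?_ ?_ ?_
  · rwa [inter_insert_of_notMem hvg]
  · rw [← insert_inter_distrib, (disjoint_iff_inter_eq_empty.1 hd2.symm)]
    simp
  · rw [disjoint_insert_right]
    exact ⟨hvg, hd.symm⟩

lemma comet {V : Finset α} {H : Finset (Finset α)} (ht : Tri V H) (hp : PF H) (v : α)
    (h1 : (H.filter (fun e => v ∉ e)).card = 1) (h5 : 5 ≤ V.card) :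
    H.card ≤ (V.card - 4).choose 2 + 4 ∨
      H.card ≤ (V.card - 1).choose 2 + 1 - (V.card - 5).choose 2 := by
  obtain ⟨g, hg⟩ := card_eq_one.1 h1
  have hgm : g ∈ H.filter (fun e => v ∉ e) := by rw [hg]; simp
  rw [mem_filter] at hgm
  obtain ⟨hgH, hvg⟩ := hgm
  obtain ⟨hgV, hg3⟩ := ht g hgH
  have hgV' : g ⊆ V.erase v := fun x hx => mem_erase.2 ⟨fun hh => hvg (hh ▸ hx), hgV hx⟩
  rw [card_split H v, h1]
  by_cases hv : v ∈ V
  swap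
  · left
    have : link H v = ∅ := by
      rw [eq_empty_iff_forall_notMem]
      intro l hl
      rw [mem_link] at hl
      exact hv ((ht _ hl.2).1 (mem_insert_self _ _))
    simp [this]
  have hVe : (V.erase v).card = V.card - 1 := card_erase_of_mem hv
  by_cases hc : ∃ l ∈ link H v, (g ∩ l).card = 1
  · right
    obtain ⟨l, hl, hgl⟩ := hc
    have hl' := link_sub ht v hl
    rw [mem_powersetCard] at hl'
    have hsub : link H v ⊆ powersetCard 2 (V.erase v) \ powersetCard 2 (V.erase v \ (g ∪ l)) := by
      intro m hm
      rw [mem_sdiff]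
      refine ⟨link_sub ht v hm, fun hmm => ?_⟩
      rw [mem_powersetCard, subset_sdiff, disjoint_union_right] at hmm
      exact hp.star hgH hvg hl hm hgl hmm.1.2.1 hmm.1.2.2
    have h4 : (g ∪ l).card = 4 := by
      have := card_union_add_card_inter g l
      omega
    have := card_le_card hsub
    rw [card_sdiff_of_subset (powersetCard_mono sdiff_subset), card_powersetCard,
      card_powersetCard, card_sdiff_of_subset (union_subset hgV' hl'.1), h4, hVe] at this
    have h2 : (V.card - 1 - 4).choose 2 ≤ (V.card - 1).choose 2 := Nat.choose_le_choose _ (by omega)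
    have h3 : V.card - 5 = V.card - 1 - 4 := by omega
    rw [h3]
    omega
  · left
    push Not at hc
    have hsub : link H v ⊆ powersetCard 2 g ∪ powersetCard 2 (V.erase v \ g) := by
      intro m hm
      have hm' := link_sub ht v hm
      rw [mem_powersetCard] at hm'
      have h2 := hc m hm
      have h3 : (g ∩ m).card ≤ m.card := card_le_card inter_subset_right
      rw [mem_union, mem_powersetCard, mem_powersetCard]
      have h4 : (g ∩ m).card = 0 ∨ (g ∩ m).card = 2 := by omega
      rcases h4 with h4 | h4
      · right
        rw [card_eq_zero] at h4
        exact ⟨subset_sdiff.2 ⟨hm'.1, (disjoint_iff_inter_eq_empty.2 h4).symm⟩, hm'.2⟩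
      · left
        have : g ∩ m = m := eq_of_subset_of_card_le inter_subset_right (by omega)
        exact ⟨by rw [← this]; exact inter_subset_left, hm'.2⟩
    have := (card_le_card hsub).trans (card_union_le _ _)
    rw [card_powersetCard, card_powersetCard, card_sdiff_of_subset hgV', hg3, hVe] at this
    have h3 : V.card - 4 = V.card - 1 - 3 := by omega
    rw [h3]
    have : Nat.choose 3 2 = 3 := rfl
    omega

/-- the main bound -/
def B (n : ℕ) : ℕ :=
  if n ≤ 8 then 20 else if n ≤ 12 then 4 * n - 13 else if n ≤ 14 then 4 * n - 12 else 50

def TwoK (V : Finset α) (H : Finset (Finset α)) : Prop :=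
  ∃ S T : Finset α, S.card = 6 ∧ T.card = 6 ∧ Disjoint S T ∧ S ∪ T = V ∧
    ∀ e ∈ H, e ⊆ S ∨ e ⊆ T

def Concl (V : Finset α) (H : Finset (Finset α)) : Prop :=
  Near H ∨ H.card ≤ B V.card ∨ (V.card = 12 ∧ TwoK V H)

def F (n : ℕ) : ℕ :=
  if n ≤ 6 then n.choose 3 else if n = 7 then 20 else (n - 1).choose 2 + 1

def IH (α : Type*) [DecidableEq α] (n : ℕ) : Prop :=
  ∀ (V : Finset α) (H : Finset (Finset α)), V.card < n → 7 ≤ V.card → Tri V H → PF H → Concl V H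

lemma twoK_card {V : Finset α} {H : Finset (Finset α)} (ht : Tri V H) (h : TwoK V H) :
    H.card ≤ 40 := by
  obtain ⟨S, T, hS, hT, -, -, h⟩ := h
  have : H ⊆ powersetCard 3 S ∪ powersetCard 3 T := by
    intro e he
    rw [mem_union, mem_powersetCard, mem_powersetCard]
    rcases h e he with h | h
    · exact Or.inl ⟨h, (ht e he).2⟩
    · exact Or.inr ⟨h, (ht e he).2⟩
  have := (card_le_card this).trans (card_union_le _ _)
  rw [card_powersetCard, card_powersetCard, hS, hT] at this
  exact this

lemma tri_card {V : Finset α} {H : Finset (Finset α)} (ht : Tri V H) :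
    H.card ≤ V.card.choose 3 := by
  rw [← card_powersetCard]
  exact card_le_card fun e he => mem_powersetCard.2 (ht e he)

lemma card_le_F {n : ℕ} (hn : n ≤ 15) (ih : IH α n) {V : Finset α} {H : Finset (Finset α)}
    (hV : V.card < n) (ht : Tri V H) (hp : PF H) : H.card ≤ F V.card := by
  by_cases h6 : V.card ≤ 6
  · rw [F, if_pos h6]
    exact tri_card ht
  · have hc := ih V H hV (by omega) ht hp
    rcases hc with hc | hc | hc
    · have := near_card ht hc
      unfold F
      by_cases h7 : V.card = 7
      · rw [h7] at this ⊢
        have h8 : Nat.choose (7-1) 2 = 15 := rfl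
        simp
        omega
      · simp [h6, h7, this]
    · refine hc.trans ?_
      generalize V.card = k at *
      have : k ≤ 14 := by omega
      clear hc hV ht
      interval_cases k <;> first | omega | decide
    · have := twoK_card ht hc.2
      rw [hc.1]
      exact this.trans (by decide)

lemma split_card {n : ℕ} (hn : n ≤ 15) (ih : IH α n) {V1 V2 : Finset α} {H : Finset (Finset α)}
    {V : Finset α} (h1 : V1.card < n) (h2 : V2.card < n) (ht : Tri V H) (hp : PF H)
    (hs : ∀ e ∈ H, e ⊆ V1 ∨ e ⊆ V2) : H.card ≤ F V1.card + F V2.card := by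
  have : H ⊆ res H V1 ∪ res H V2 := by
    intro e he
    simp only [res, mem_union, mem_filter]
    rcases hs e he with h | h <;> simp [he, h]
  refine (card_le_card this).trans ((card_union_le _ _).trans ?_)
  exact add_le_add (card_le_F hn ih h1 (ht.res _) (hp.res _))
    (card_le_F hn ih h2 (ht.res _) (hp.res _))

lemma split_num : ∀ k l : ℕ, 3 ≤ k → k ≤ l → k + l ≤ 15 → 7 ≤ k + l →
    F k + F l ≤ B (k + l) ∨ (k = 3 ∧ 11 ≤ l) ∨ (k = 6 ∧ l = 6) := by
  intro k l h1 h2 h3 h4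
  have hk : k ≤ 7 := by omega
  have hl : l ≤ 12 := by omega
  interval_cases k <;> interval_cases l <;> first | omega | (left; decide) | skip

lemma split_aux {n : ℕ} (hn : n ≤ 15) (hn7 : 7 ≤ n) (ih : IH α n) {V V1 V2 : Finset α}
    {H : Finset (Finset α)} (hV : V.card = n)
    (h1 : 3 ≤ V1.card) (h2 : V1.card ≤ V2.card) (hd : Disjoint V1 V2) (hu : V1 ∪ V2 = V)
    (ht : Tri V H) (hp : PF H)
    (hs : ∀ e ∈ H, e ⊆ V1 ∨ e ⊆ V2) : Concl V H := by
  have hc : V1.card + V2.card = n := by rw [← hV, ← hu, card_union_of_disjoint hd]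
  have hb := split_card hn ih (by omega) (by omega) ht hp hs
  rcases split_num _ _ h1 h2 (by omega) (by omega) with h | h | h
  · right; left
    rw [hc] at h
    rw [hV]
    exact hb.trans h
  · -- one edge plus the rest
    have hsplit : H ⊆ powersetCard 3 V1 ∪ res H V2 := by
      intro e he
      simp only [res, mem_union, mem_filter, mem_powersetCard]
      rcases hs e he with h | h <;> simp [he, h, (ht e he).2]
    have hcH := (card_le_card hsplit).trans (card_union_le _ _)
    rw [card_powersetCard, h.1, Nat.choose_self] at hcH
    have hl : V2.card = 11 ∨ V2.card = 12 := by omega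
    rcases ih V2 (res H V2) (by omega) (by omega) (ht.res _) (hp.res _) with h' | h' | h'
    · obtain ⟨v, hv⟩ := h'
      have hv2 : (filter (fun e => v ∉ e) (res H V2)).card = 0 ∨
        (filter (fun e => v ∉ e) (res H V2)).card = 1 := by omega
      rcases hv2 with hv2 | hv2
      · left
        refine ⟨v, ?_⟩
        have : H.filter (fun e => v ∉ e) ⊆ powersetCard 3 V1 := by
          intro e he
          rw [mem_filter] at he
          have := hsplit he.1
          rw [mem_union] at this
          rcases this with h | h
          · exact h
          · rw [card_eq_zero, filter_eq_empty_iff] at hv2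
            exact absurd he.2 (hv2 h)
        have := card_le_card this
        rwa [card_powersetCard, h.1, Nat.choose_self] at this
      · right; left
        have := comet (ht.res V2) (hp.res V2) v hv2 (by omega)
        rw [hV]
        rcases hl with hl | hl
        · have : n = 14 := by omega
          subst this
          rw [hl] at this
          simp [Nat.choose] at this
          simp [B]
          omega
        · have : n = 15 := by omega
          subst this
          rw [hl] at this
          simp [Nat.choose] at this
          simp [B]
          omega
    · right; left
      rw [hV]
      rcases hl with hl | hl
      · have : n = 14 := by omega
        subst this
        rw [hl] at h'
        simp [B] at h' ⊢
        omega
      · have : n = 15 := by omega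
        subst this
        rw [hl] at h'
        simp [B] at h' ⊢
        omega
    · right; left
      have := twoK_card (ht.res V2) h'.2
      rw [hV, show n = 15 by omega]
      simp [B]
      omega
  · right; right
    exact ⟨by omega, V1, V2, h.1, h.2, hd, hu, hs⟩

lemma split_concl {n : ℕ} (hn : n ≤ 15) (hn7 : 7 ≤ n) (ih : IH α n) {V V1 V2 : Finset α}
    {H : Finset (Finset α)} (hV : V.card = n)
    (h1 : 3 ≤ V1.card) (h2 : 3 ≤ V2.card) (hd : Disjoint V1 V2) (hu : V1 ∪ V2 = V)
    (ht : Tri V H) (hp : PF H)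
    (hs : ∀ e ∈ H, e ⊆ V1 ∨ e ⊆ V2) : Concl V H := by
  rcases le_total V1.card V2.card with h | h
  · exact split_aux hn hn7 ih hV h1 h hd hu ht hp hs
  · exact split_aux hn hn7 ih hV h2 h hd.symm (by rw [union_comm]; exact hu) ht hp
      (fun e he => (hs e he).symm)

end LP

namespace LP
open Finset

variable {α : Type*} [DecidableEq α]

lemma two_meet {W : Finset α} {G : Finset (Finset α)} (hG : ∀ m ∈ G, m ⊆ W ∧ m.card = 2)
    (hW : 4 ≤ W.card) {p q : Finset α} (hp : p ⊆ W ∧ p.card = 2) (hq : q ⊆ W ∧ q.card = 2)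
    (hpq : p ≠ q) (hmp : ∀ m ∈ G, ¬ Disjoint m p) (hmq : ∀ m ∈ G, ¬ Disjoint m q) :
    G.card ≤ W.card := by
  by_cases hd : Disjoint p q
  · obtain ⟨u, v, huv, rfl⟩ := card_eq_two.1 hp.2
    obtain ⟨s, t, hst, rfl⟩ := card_eq_two.1 hq.2
    have : G ⊆ {{u, s}, {u, t}, {v, s}, {v, t}} := by
      intro m hm
      obtain ⟨i, j, hij, rfl⟩ := card_eq_two.1 (hG m hm).2
      have h1 := hmp _ hm
      have h2 := hmq _ hm
      simp only [disjoint_insert_left, disjoint_singleton_left, mem_insert, mem_singleton,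
        not_and_or, not_not, not_or] at h1 h2 hd ⊢
      have hc : ∀ a b : α, ({a, b} : Finset α) = {b, a} := fun a b => pair_comm a b
      grind
    have := (card_le_card this).trans card_le_four
    omega
  · rw [not_disjoint_iff] at hd
    obtain ⟨u, hup, huq⟩ := hd
    obtain ⟨v, hv⟩ := card_eq_one.1 (by rw [card_erase_of_mem hup, hp.2] : (p.erase u).card = 1)
    obtain ⟨t, ht⟩ := card_eq_one.1 (by rw [card_erase_of_mem huq, hq.2] : (q.erase u).card = 1)
    have hp' : p = {u, v} := by rw [← insert_erase hup, hv]
    have hq' : q = {u, t} := by rw [← insert_erase huq, ht]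
    subst hp' hq'
    have hsub : G ⊆ insert {v, t} ((W.erase u).image (fun z => {u, z})) := by
      intro m hm
      have hm' := hG m hm
      by_cases hum : u ∈ m
      · obtain ⟨z, hz⟩ := card_eq_one.1
          (by rw [card_erase_of_mem hum, hm'.2] : (m.erase u).card = 1)
        rw [mem_insert, mem_image]
        right
        refine ⟨z, ?_, by rw [← hz, insert_erase hum]⟩
        have : z ∈ m.erase u := by rw [hz]; simp
        rw [mem_erase] at this ⊢
        exact ⟨this.1, hm'.1 this.2⟩
      · rw [mem_insert]
        left
        obtain ⟨i, j, hij, rfl⟩ := card_eq_two.1 hm'.2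
        have h1 := hmp _ hm
        have h2 := hmq _ hm
        simp only [disjoint_insert_left, disjoint_singleton_left, mem_insert, mem_singleton,
          not_and_or, not_not, not_or] at h1 h2 hum ⊢
        have hc : ∀ a b : α, ({a, b} : Finset α) = {b, a} := fun a b => pair_comm a b
        grind
    have h1 := card_le_card hsub
    have h2 := (h1.trans (card_insert_le _ _))
    have h3 : ((W.erase u).image (fun z => ({u, z} : Finset α))).card ≤ (W.erase u).card :=
      card_image_le
    rw [card_erase_of_mem (hp.1 hup)] at h3
    omega

/-- one pair: edges meeting it -/
lemma one_meet {W : Finset α} {G : Finset (Finset α)} (hG : ∀ m ∈ G, m ⊆ W ∧ m.card = 2)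
    {p : Finset α} (hp : p ⊆ W ∧ p.card = 2)
    (hmp : ∀ m ∈ G, ¬ Disjoint m p) :
    G.card + 2 ≤ 2 * W.card := by
  have hsub : G ⊆ p.biUnion (fun u => (W.erase u).image (fun z => {u, z})) := by
    intro m hm
    obtain ⟨u, hum, hup⟩ := not_disjoint_iff.1 (hmp m hm)
    obtain ⟨z, hz⟩ := card_eq_one.1
      (by rw [card_erase_of_mem hum, (hG m hm).2] : (m.erase u).card = 1)
    rw [mem_biUnion]
    refine ⟨u, hup, mem_image.2 ⟨z, ?_, by rw [← hz, insert_erase hum]⟩⟩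
    have : z ∈ m.erase u := by rw [hz]; simp
    rw [mem_erase] at this ⊢
    exact ⟨this.1, (hG m hm).1 this.2⟩
  have h1 := (card_le_card hsub).trans (card_biUnion_le_card_mul _ _ (W.card - 1) (by
    intro u hu
    refine card_image_le.trans ?_
    rw [card_erase_of_mem (hp.1 hu)]))
  have h2 : 2 ≤ W.card := hp.2 ▸ card_le_card hp.1
  rw [hp.2] at h1
  omega

lemma inter_small {V : Finset α} {H : Finset (Finset α)} (ht : Tri V H)
    (hi : ∀ e ∈ H, ∀ f ∈ H, ¬ Disjoint e f) (hn : ¬ Near H)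
    (hc : ∀ x y, x ≠ y → (H.filter (fun e => x ∈ e ∧ y ∈ e)).card ≤ 2) : H.card ≤ 18 := by
  have hdeg : ∀ v, (H.filter (fun e => v ∈ e)).card ≤ 6 := by
    intro v
    have : (H.filter (fun e => v ∉ e)).Nonempty := by
      rw [← card_pos]
      by_contra h
      exact hn ⟨v, by omega⟩
    obtain ⟨f, hf⟩ := this
    rw [mem_filter] at hf
    have hsub : H.filter (fun e => v ∈ e) ⊆ f.biUnion (fun u => H.filter (fun e => v ∈ e ∧ u ∈ e)) := by
      intro e he
      rw [mem_filter] at he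
      obtain ⟨u, hue, huf⟩ := not_disjoint_iff.1 (hi e he.1 f hf.1)
      rw [mem_biUnion]
      exact ⟨u, huf, mem_filter.2 ⟨he.1, he.2, hue⟩⟩
    have := (card_le_card hsub).trans (card_biUnion_le_card_mul _ _ 2 (by
      intro u hu
      exact hc v u (fun h => hf.2 (h ▸ hu))))
    rw [(ht f hf.1).2] at this
    omega
  rcases H.eq_empty_or_nonempty with rfl | ⟨e0, he0⟩
  · simp
  have hsub : H ⊆ e0.biUnion (fun u => H.filter (fun e => u ∈ e)) := by
    intro e he
    obtain ⟨u, hue, huf⟩ := not_disjoint_iff.1 (hi e he e0 he0)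
    rw [mem_biUnion]
    exact ⟨u, huf, mem_filter.2 ⟨he, hue⟩⟩
  have := (card_le_card hsub).trans (card_biUnion_le_card_mul _ _ 6 (fun u _ => hdeg u))
  rw [(ht e0 he0).2] at this
  omega

lemma inter_big {V : Finset α} {H : Finset (Finset α)} (ht : Tri V H) (hV : 7 ≤ V.card)
    (hi : ∀ e ∈ H, ∀ f ∈ H, ¬ Disjoint e f) (hn : ¬ Near H) {x y : α} (hxy : x ≠ y)
    (hc : 3 ≤ (H.filter (fun e => x ∈ e ∧ y ∈ e)).card) : H.card ≤ 3 * V.card - 6 := by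
  set W := (V.erase x).erase y with hW
  obtain ⟨e0, he0⟩ := card_pos.1 (by omega : 0 < (H.filter (fun e => x ∈ e ∧ y ∈ e)).card)
  rw [mem_filter] at he0
  have hxV : x ∈ V := (ht e0 he0.1).1 he0.2.1
  have hyV : y ∈ V := (ht e0 he0.1).1 he0.2.2
  have hWc : W.card = V.card - 2 := by
    rw [hW, card_erase_of_mem (mem_erase.2 ⟨hxy.symm, hyV⟩), card_erase_of_mem hxV]
    omega
  set L2 := link (link H x) y with hL2
  set Gx := (link H x).filter (fun m => y ∉ m) with hGx
  set H' := H.filter (fun e => x ∉ e) with hH'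
  set Gy := link H' y with hGy
  set N := H'.filter (fun e => y ∉ e) with hN
  have e1 : H.card = L2.card + Gx.card + (Gy.card + N.card) := by
    rw [card_split H x, card_split (link H x) y, ← hH', card_split H' y]
  have e2 : L2.card = (H.filter (fun e => x ∈ e ∧ y ∈ e)).card := by
    have h1 : (H.filter (fun e => x ∈ e ∧ y ∈ e)).card
        = (link (H.filter (fun e => y ∈ e)) x).card := by
      rw [card_link, filter_filter]
      congr 1
      ext m
      simp only [mem_filter, and_comm]
    rw [hL2, card_link, h1]
    congr 1
    ext m
    simp only [mem_filter, mem_link, mem_insert]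
    constructor
    · rintro ⟨⟨h1, h2⟩, h3⟩
      exact ⟨h1, h2, Or.inr h3⟩
    · rintro ⟨h1, h2, h3⟩
      exact ⟨⟨h1, h2⟩, h3.resolve_left hxy.symm⟩
  have memL2 : ∀ l ∈ L2, l ⊆ W ∧ l.card = 1 ∧ insert x (insert y l) ∈ H := by
    intro l hl
    rw [hL2, mem_link, mem_link] at hl
    obtain ⟨h1, h2, h3⟩ := hl
    have h4 := ht _ h3
    have h5 := h4.2
    rw [card_insert_of_notMem h2, card_insert_of_notMem h1] at h5
    refine ⟨fun z hz => ?_, by omega, h3⟩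
    rw [hW, mem_erase, mem_erase]
    refine ⟨fun h => h1 (h ▸ hz), fun h => h2 (mem_insert_of_mem (h ▸ hz)), ?_⟩
    exact h4.1 (mem_insert_of_mem (mem_insert_of_mem hz))
  have cL2 : L2.card ≤ V.card - 2 := by
    have : L2 ⊆ powersetCard 1 W := fun l hl =>
      mem_powersetCard.2 ⟨(memL2 l hl).1, (memL2 l hl).2.1⟩
    have := card_le_card this
    rwa [card_powersetCard, Nat.choose_one_right, hWc] at this
  have fN : ∀ f ∈ N, L2 = powersetCard 1 f := by
    intro f hf
    rw [hN, mem_filter, hH', mem_filter] at hf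
    have hsub : L2 ⊆ powersetCard 1 f := by
      intro l hl
      obtain ⟨h1, h2, h3⟩ := memL2 l hl
      have h4 := hi _ h3 f hf.1.1
      rw [disjoint_insert_left, disjoint_insert_left] at h4
      obtain ⟨z, rfl⟩ := card_eq_one.1 h2
      rw [mem_powersetCard]
      refine ⟨?_, h2⟩
      rw [disjoint_singleton_left] at h4
      rw [singleton_subset_iff]
      by_contra h5
      exact h4 ⟨hf.1.2, hf.2, h5⟩
    refine eq_of_subset_of_card_le hsub ?_
    rw [card_powersetCard, (ht f hf.1.1).2]
    simp
    omega
  have cN : N.card ≤ 1 := by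
    rw [card_le_one]
    intro f hf g hg
    have h1 := (fN f hf).symm.trans (fN g hg)
    ext z
    have : ({z} : Finset α) ∈ powersetCard 1 f ↔ ({z} : Finset α) ∈ powersetCard 1 g := by rw [h1]
    simpa [mem_powersetCard] using this
  have cNL : L2.card + N.card ≤ V.card - 2 := by
    rcases N.eq_empty_or_nonempty with h | ⟨f, hf⟩
    · rw [h]; simpa using cL2
    · have h1 := fN f hf
      rw [hN, mem_filter, hH', mem_filter] at hf
      have : L2.card = 3 := by
        rw [h1, card_powersetCard, (ht f hf.1.1).2]
        rfl
      omega
  have memGx : ∀ m ∈ Gx, m ⊆ W ∧ m.card = 2 := by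
    intro m hm
    rw [hGx, mem_filter] at hm
    have := mem_powersetCard.1 (link_sub ht x hm.1)
    refine ⟨fun z hz => mem_erase.2 ⟨fun h => hm.2 (h ▸ hz), this.1 hz⟩, this.2⟩
  have memGy : ∀ m ∈ Gy, m ⊆ W ∧ m.card = 2 := by
    intro m hm
    have := mem_powersetCard.1 (link_sub (ht.mono (filter_subset _ _) : Tri V H') y hm)
    rw [hGy, mem_link, hH', mem_filter] at hm
    refine ⟨fun z hz => ?_, this.2⟩
    have h2 := mem_erase.1 (this.1 hz)
    refine mem_erase.2 ⟨h2.1, mem_erase.2 ⟨fun h => hm.2.2 (mem_insert_of_mem (h ▸ hz)), h2.2⟩⟩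
  have cross : ∀ m ∈ Gx, ∀ p ∈ Gy, ¬ Disjoint m p := by
    intro m hm p hp hd
    have hm' := (memGx m hm).1
    rw [hGx, mem_filter, mem_link] at hm
    rw [hGy, mem_link, hH', mem_filter] at hp
    refine hi _ hm.1.2 _ hp.2.1 ?_
    rw [disjoint_insert_left, disjoint_insert_right]
    exact ⟨hp.2.2, hm.2, hd⟩
  have nGy : 1 ≤ Gy.card := by
    by_contra h
    refine hn ⟨x, ?_⟩
    rw [← hH', card_split H' y, ← hGy, ← hN]
    omega
  have nGx : 1 ≤ Gx.card := by
    by_contra h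
    refine hn ⟨y, ?_⟩
    have : H.filter (fun e => y ∉ e) ⊆ N := by
      intro e he
      rw [mem_filter] at he
      rw [hN, mem_filter, hH', mem_filter]
      refine ⟨⟨he.1, fun hx => h ?_⟩, he.2⟩
      refine card_pos.2 ⟨e.erase x, ?_⟩
      rw [hGx, mem_filter, mem_link]
      refine ⟨⟨notMem_erase _ _, by rw [insert_erase hx]; exact he.1⟩, fun h => he.2 (mem_of_mem_erase h)⟩
    exact (card_le_card this).trans cN
  have main : Gx.card + Gy.card ≤ 2 * W.card := by
    obtain ⟨p0, hp0⟩ := card_pos.1 nGx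
    obtain ⟨q0, hq0⟩ := card_pos.1 nGy
    by_cases hx1 : Gx.card = 1
    · have := one_meet memGy (memGx p0 hp0) (fun m hm h => cross p0 hp0 m hm h.symm)
      omega
    by_cases hy1 : Gy.card = 1
    · have := one_meet memGx (memGy q0 hq0) (fun m hm h => cross m hm q0 hq0 h)
      omega
    obtain ⟨p, hp, p', hp', hpp⟩ := one_lt_card.1 (by omega : 1 < Gx.card)
    obtain ⟨q, hq, q', hq', hqq⟩ := one_lt_card.1 (by omega : 1 < Gy.card)
    have h1 := two_meet memGx (by omega) (memGy q hq) (memGy q' hq') hqq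
      (fun m hm => cross m hm q hq) (fun m hm => cross m hm q' hq')
    have h2 := two_meet memGy (by omega) (memGx p hp) (memGx p' hp') hpp
      (fun m hm h => cross p hp m hm h.symm) (fun m hm h => cross p' hp' m hm h.symm)
    omega
  omega

lemma inter_concl {V : Finset α} {H : Finset (Finset α)} (ht : Tri V H) (hV : 7 ≤ V.card)
    (hV' : V.card ≤ 15) (hi : ∀ e ∈ H, ∀ f ∈ H, ¬ Disjoint e f) : Concl V H := by
  by_cases hn : Near H
  · exact Or.inl hn
  right; left
  by_cases hc : ∀ x y, x ≠ y → (H.filter (fun e => x ∈ e ∧ y ∈ e)).card ≤ 2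
  · have := inter_small ht hi hn hc
    unfold B
    split_ifs <;> omega
  · push Not at hc
    obtain ⟨x, y, hxy, hc⟩ := hc
    have := inter_big ht hV hi hn hxy hc
    unfold B
    split_ifs <;> omega

/-- no connected disjoint pair: splits -/
lemma caseC {n : ℕ} (hn : n ≤ 15) (hn7 : 7 ≤ n) (ih : IH α n) {V : Finset α}
    {H : Finset (Finset α)} (hV : V.card = n) (ht : Tri V H) (hp : PF H)
    {e f : Finset α} (he : e ∈ H) (hf : f ∈ H) (hef : Disjoint e f)
    (hno : ∀ e ∈ H, ∀ f ∈ H, ∀ g ∈ H, Disjoint e f → Disjoint g e ∨ Disjoint g f) :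
    Concl V H := by
  set V1 := (H.filter (fun g => ¬ Disjoint g e)).biUnion id with hV1
  have hV1V : V1 ⊆ V := by
    intro z hz
    rw [hV1, mem_biUnion] at hz
    obtain ⟨g, hg, hz⟩ := hz
    exact (ht g (mem_filter.1 hg).1).1 hz
  have hs : ∀ g ∈ H, g ⊆ V1 ∨ g ⊆ V \ V1 := by
    intro g hg
    by_cases hge : Disjoint g e
    · right
      rw [subset_sdiff]
      refine ⟨(ht g hg).1, ?_⟩
      rw [hV1, disjoint_biUnion_right]
      intro h hh
      rw [mem_filter] at hh
      rcases hno g hg e he h hh.1 hge with h1 | h1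
      · exact h1.symm
      · exact absurd h1 hh.2
    · left
      exact fun z hz => mem_biUnion.2 ⟨g, mem_filter.2 ⟨hg, hge⟩, hz⟩
  have hene : ¬ Disjoint e e := by
    rw [disjoint_self]
    intro h
    have := (ht e he).2
    rw [h] at this
    simp at this
  have heV : e ⊆ V1 := fun z hz => mem_biUnion.2 ⟨e, mem_filter.2 ⟨he, hene⟩, hz⟩
  have hfV : f ⊆ V \ V1 := by
    rcases hs f hf with h | h
    · exfalso
      have hfne : f.Nonempty := by
        rw [← card_pos, (ht f hf).2]; omega
      obtain ⟨z, hz⟩ := hfne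
      obtain ⟨g, hg, hzg⟩ := mem_biUnion.1 (h hz)
      rw [mem_filter] at hg
      rcases hno e he f hf g hg.1 hef with h1 | h1
      · exact hg.2 h1
      · exact disjoint_left.1 h1 hzg hz
    · exact h
  refine split_concl hn hn7 ih hV ?_ ?_ disjoint_sdiff (union_sdiff_of_subset hV1V) ht hp hs
  · rw [← (ht e he).2]; exact card_le_card heV
  · rw [← (ht f hf).2]; exact card_le_card hfV

end LP

namespace LP
open Finset

variable {α : Type*} [DecidableEq α]

/-- elementwise edge predicate -/
def T (H : Finset (Finset α)) (a b c : α) : Prop := ({a, b, c} : Finset α) ∈ H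

lemma T.s12 {H : Finset (Finset α)} {a b c : α} (h : T H a b c) : T H b a c := by
  unfold T at *; rwa [Finset.insert_comm]

lemma T.s23 {H : Finset (Finset α)} {a b c : α} (h : T H a b c) : T H a c b := by
  unfold T at *; rwa [Finset.pair_comm]

lemma T.s13 {H : Finset (Finset α)} {a b c : α} (h : T H a b c) : T H c b a := h.s12.s23.s12
/-- `bca` -/
lemma T.rot {H : Finset (Finset α)} {a b c : α} (h : T H a b c) : T H b c a := h.s12.s23
/-- `cab` -/
lemma T.rot2 {H : Finset (Finset α)} {a b c : α} (h : T H a b c) : T H c a b := h.s23.s12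

lemma T.ne {V : Finset α} {H : Finset (Finset α)} (ht : Tri V H) {a b c : α} (h : T H a b c) :
    a ≠ b ∧ a ≠ c ∧ b ≠ c := by
  have := (ht _ h).2
  refine ⟨?_, ?_, ?_⟩ <;> rintro rfl <;> revert this
  · rw [insert_eq_of_mem (by simp)]
    have := card_le_two (a := a) (b := c)
    omega
  · rw [insert_eq_of_mem (by simp)]
    have := card_le_two (a := b) (b := a)
    omega
  · rw [pair_eq_singleton]
    have := card_le_two (a := a) (b := b)
    omega

lemma T.mem {V : Finset α} {H : Finset (Finset α)} (ht : Tri V H) {a b c : α} (h : T H a b c) :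
    a ∈ V ∧ b ∈ V ∧ c ∈ V := by
  have := (ht _ h).1
  exact ⟨this (by simp), this (by simp), this (by simp)⟩

lemma exT {V : Finset α} {H : Finset (Finset α)} (ht : Tri V H) {e : Finset α} (he : e ∈ H) :
    ∃ a b c, T H a b c ∧ e = {a, b, c} := by
  obtain ⟨a, b, c, -, -, -, rfl⟩ := card_eq_three.1 (ht e he).2
  exact ⟨a, b, c, he, rfl⟩

/-- an edge through `v` -/
lemma exT_mem {V : Finset α} {H : Finset (Finset α)} (ht : Tri V H) {e : Finset α} (he : e ∈ H)
    {v : α} (hv : v ∈ e) : ∃ a b, T H v a b ∧ e = {v, a, b} := by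
  obtain ⟨a, b, c, h, rfl⟩ := exT ht he
  simp only [mem_insert, mem_singleton] at hv
  rcases hv with rfl | rfl | rfl
  · exact ⟨_, _, h, rfl⟩
  · exact ⟨_, _, h.s12, by rw [Finset.insert_comm]⟩
  · exact ⟨_, _, h.rot2, by ext; simp; tauto⟩

/-- an edge through `v` and `u` -/
lemma exT_mem2 {V : Finset α} {H : Finset (Finset α)} (ht : Tri V H) {e : Finset α} (he : e ∈ H)
    {u v : α} (hv : v ∈ e) (hu : u ∈ e) (huv : v ≠ u) : ∃ b, T H v u b ∧ e = {v, u, b} := by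
  obtain ⟨a, b, h, rfl⟩ := exT_mem ht he hv
  simp only [mem_insert, mem_singleton] at hu
  rcases hu with rfl | rfl | rfl
  · exact absurd rfl huv
  · exact ⟨_, h, rfl⟩
  · exact ⟨_, h.s23, by rw [Finset.pair_comm]⟩

/-- elementwise absence of the loose path. -/
lemma PF.p7 {H : Finset (Finset α)} (hp : PF H) {a b c d e f g : α} (h1 : T H a b c)
    (h2 : T H c d e) (h3 : T H e f g)
    (h : (a ≠ c ∧ a ≠ d ∧ a ≠ e ∧ a ≠ f ∧ a ≠ g ∧ b ≠ c ∧ b ≠ d ∧ b ≠ e ∧ b ≠ f ∧ b ≠ g) ∧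
      c ≠ e ∧ c ≠ f ∧ c ≠ g ∧ d ≠ e ∧ d ≠ f ∧ d ≠ g ∧ c ≠ d ∧ e ≠ f ∧ e ≠ g) : False := by
  refine hp _ h1 _ h2 _ h3 ?_ ?_ ?_
  · rw [card_eq_one]
    refine ⟨c, ?_⟩
    ext t
    simp only [mem_inter, mem_insert, mem_singleton]
    grind
  · rw [card_eq_one]
    refine ⟨e, ?_⟩
    ext t
    simp only [mem_inter, mem_insert, mem_singleton]
    grind
  · rw [disjoint_left]
    intro t
    simp only [mem_insert, mem_singleton]
    grind

structure Cfg (H : Finset (Finset α)) (a b c d x y z w : α) : Prop where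
  abc : T H a b c
  bcd : T H b c d
  dxy : T H d x y
  dzw : T H d z w
  n1 : a ≠ b ∧ a ≠ c ∧ a ≠ d ∧ a ≠ x ∧ a ≠ y ∧ a ≠ z ∧ a ≠ w
  n2 : b ≠ c ∧ b ≠ d ∧ b ≠ x ∧ b ≠ y ∧ b ≠ z ∧ b ≠ w
  n3 : c ≠ d ∧ c ≠ x ∧ c ≠ y ∧ c ≠ z ∧ c ≠ w
  n4 : d ≠ x ∧ d ≠ y ∧ d ≠ z ∧ d ≠ w ∧ x ≠ y ∧ x ≠ z ∧ x ≠ w ∧ y ≠ z ∧ y ≠ w ∧ z ≠ w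

section
variable {H : Finset (Finset α)} {a b c d x y z w : α}

lemma Cfg.sbc (h : Cfg H a b c d x y z w) : Cfg H a c b d x y z w := by
  obtain ⟨h1, h2, h3, h4, n1, n2, n3, n4⟩ := h
  exact ⟨h1.s23, h2.s12, h3, h4, by tauto, by grind, by tauto, n4⟩

lemma Cfg.sxy (h : Cfg H a b c d x y z w) : Cfg H a b c d y x z w := by
  obtain ⟨h1, h2, h3, h4, n1, n2, n3, n4⟩ := h
  exact ⟨h1, h2, h3.s23, h4, by tauto, by tauto, by tauto, by grind⟩

lemma Cfg.szw (h : Cfg H a b c d x y z w) : Cfg H a b c d x y w z := by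
  obtain ⟨h1, h2, h3, h4, n1, n2, n3, n4⟩ := h
  exact ⟨h1, h2, h3, h4.s23, by tauto, by tauto, by tauto, by grind⟩

lemma Cfg.st (h : Cfg H a b c d x y z w) : Cfg H a b c d z w x y := by
  obtain ⟨h1, h2, h3, h4, n1, n2, n3, n4⟩ := h
  exact ⟨h1, h2, h4, h3, by tauto, by tauto, by tauto, by grind⟩

/-- every single vertex avoids one of the tails -/
lemma Cfg.tail (h : Cfg H a b c d x y z w) (q : α) :
    ∃ s t, T H d s t ∧ q ≠ s ∧ q ≠ t ∧ s ≠ a ∧ s ≠ b ∧ s ≠ c ∧ s ≠ d ∧ t ≠ a ∧ t ≠ b ∧ t ≠ c ∧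
      t ≠ d := by
  obtain ⟨h1, h2, h3, h4, n1, n2, n3, n4⟩ := h
  by_cases hq : q = x ∨ q = y
  · exact ⟨z, w, h4, by grind⟩
  · exact ⟨x, y, h3, by grind⟩

lemma Cfg.cl1 (h : Cfg H a b c d x y z w) (hp : PF H) {u v : α} (hu : u = a ∨ u = b ∨ u = c)
    (hv : v ≠ a ∧ v ≠ b ∧ v ≠ c ∧ v ≠ d) (hl : T H d u v) : False := by
  obtain ⟨s, t, h5, h6⟩ := h.tail v
  obtain ⟨h1, h2, h3, h4, n1, n2, n3, n4⟩ := h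
  rcases hu with rfl | rfl | rfl
  · exact hp.p7 h1.rot hl.rot h5 (by grind)
  · exact hp.p7 h1.s23 hl.rot h5 (by grind)
  · exact hp.p7 h1 hl.rot h5 (by grind)

lemma Cfg.l1 (h : Cfg H a b c d x y z w) (hp : PF H) {q : α}
    (hq : q ≠ a ∧ q ≠ b ∧ q ≠ c ∧ q ≠ d) (hl : T H a b q) : False := by
  obtain ⟨s, t, h5, h6⟩ := h.tail q
  obtain ⟨h1, h2, h3, h4, n1, n2, n3, n4⟩ := h
  exact hp.p7 hl.s23 h2 h5 (by grind)

lemma Cfg.l2 (h : Cfg H a b c d x y z w) (hp : PF H) {p q : α} (hpq : p ≠ q)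
    (hP : p ≠ a ∧ p ≠ b ∧ p ≠ c ∧ p ≠ d)
    (hq : q ≠ a ∧ q ≠ b ∧ q ≠ c ∧ q ≠ d) (hl : T H b p q) : False := by
  have key : ∀ {p q x y : α}, T H d x y → p ≠ q → (p ≠ a ∧ p ≠ b ∧ p ≠ c ∧ p ≠ d) →
      (q ≠ a ∧ q ≠ b ∧ q ≠ c ∧ q ≠ d) → T H b p q → p = x → q ≠ y → 
      y ≠ a ∧ y ≠ b ∧ y ≠ c ∧ y ≠ d ∧ x ≠ y → False := by
    intro p q x y h3 hpq hP hq hl hpx hqy hy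
    obtain ⟨h1, h2, -, -, n1, n2, n3, n4⟩ := h
    subst hpx
    exact hp.p7 h1.s23 hl.s23 h3.s12 (by grind)
  have key2 := @key p q
  have key3 := @key q p
  obtain ⟨h1, h2, h3, h4, n1, n2, n3, n4⟩ := h
  by_cases c1 : p ≠ x ∧ p ≠ y ∧ q ≠ x ∧ q ≠ y
  · exact hp.p7 hl.rot h2 h3 (by grind)
  by_cases c2 : p ≠ z ∧ p ≠ w ∧ q ≠ z ∧ q ≠ w
  · exact hp.p7 hl.rot h2 h4 (by grind)
  have k1 := key2 h3 hpq hP hq hl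
  have k2 := key2 h3.s23 hpq hP hq hl
  have k3 := key3 h3 hpq.symm hq hP hl.s23
  have k4 := key3 h3.s23 hpq.symm hq hP hl.s23
  grind

lemma Cfg.l3 (h : Cfg H a b c d x y z w) (hp : PF H) {u p q v : α}
    (hP : p ≠ b ∧ p ≠ c ∧ p ≠ d) (hq : q ≠ b ∧ q ≠ c ∧ q ≠ d)
    (hu : u ≠ a ∧ u ≠ b ∧ u ≠ c ∧ u ≠ d) (hn : p ≠ q ∧ u ≠ p ∧ u ≠ q ∧ v ≠ u ∧ v ≠ p ∧ v ≠ q ∧ v ≠ d)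
    (hg : T H u p q) (hl : T H d u v) : False := by
  by_cases hv : v = b ∨ v = c
  · exact h.cl1 hp (u := v) (v := u) (by tauto) hu hl.s23
  obtain ⟨h1, h2, h3, h4, n1, n2, n3, n4⟩ := h
  exact hp.p7 hg.rot hl.rot h2.rot2 (by grind)

lemma Cfg.l4 (h : Cfg H a b c d x y z w) (hp : PF H) {p q v : α}
    (hP : p ≠ a ∧ p ≠ b ∧ p ≠ c ∧ p ≠ d) (hq : q ≠ a ∧ q ≠ b ∧ q ≠ c ∧ q ≠ d)
    (hn : p ≠ q ∧ v ≠ a ∧ v ≠ p ∧ v ≠ q ∧ v ≠ d)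
    (hg : T H a p q) (hl : T H d a v) : False := by
  have hv : v = b ∨ v = c := by
    by_contra hv
    exact h.cl1 hp (u := a) (v := v) (by tauto) (by tauto) hl
  have key : ∀ {p q x y : α}, T H d x y → p ≠ q → (p ≠ a ∧ p ≠ b ∧ p ≠ c ∧ p ≠ d) →
      (q ≠ a ∧ q ≠ b ∧ q ≠ c ∧ q ≠ d) → T H a p q → p = x → q ≠ y → 
      y ≠ a ∧ y ≠ b ∧ y ≠ c ∧ y ≠ d ∧ x ≠ y → False := by
    intro p q x y h3 hpq hP hq hl hpx hqy hy
    obtain ⟨h1, h2, -, -, n1, n2, n3, n4⟩ := h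
    subst hpx
    exact hp.p7 h1.rot hl.s23 h3.s12 (by grind)
  have key2 := @key p q
  have key3 := @key q p
  obtain ⟨h1, h2, h3, h4, n1, n2, n3, n4⟩ := h
  by_cases c1 : p ≠ x ∧ p ≠ y ∧ q ≠ x ∧ q ≠ y
  · exact hp.p7 hg.rot hl.rot h3 (by grind)
  by_cases c2 : p ≠ z ∧ p ≠ w ∧ q ≠ z ∧ q ≠ w
  · exact hp.p7 hg.rot hl.rot h4 (by grind)
  have k1 := key2 h3 hn.1 hP hq hg
  have k2 := key2 h3.s23 hn.1 hP hq hg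
  have k3 := key3 h3 hn.1.symm hq hP hg.s23
  have k4 := key3 h3.s23 hn.1.symm hq hP hg.s23
  grind

lemma Cfg.l5 (h : Cfg H a b c d x y z w) (hp : PF H) {p v : α}
    (hP : p ≠ a ∧ p ≠ b ∧ p ≠ c ∧ p ≠ d)
    (hn : v ≠ b ∧ v ≠ c ∧ v ≠ p ∧ v ≠ d)
    (hg : T H b c p) (hl : T H d b v) : False := by
  have hv : v = a := by
    by_contra hv
    exact h.cl1 hp (u := b) (v := v) (by tauto) (by tauto) hl
  subst hv
  obtain ⟨s, t, h5, h6⟩ := h.tail p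
  obtain ⟨h1, h2, h3, h4, n1, n2, n3, n4⟩ := h
  exact hp.p7 hg.rot hl.rot h5 (by grind)

lemma Cfg.l6 (h : Cfg H a b c d x y z w) (hp : PF H) {p v : α}
    (hP : p ≠ a ∧ p ≠ b ∧ p ≠ c ∧ p ≠ d)
    (hn : v ≠ b ∧ v ≠ c ∧ v ≠ p ∧ v ≠ d)
    (hg : T H b c p) (hl : T H d p v) : False := by
  have hv : v ≠ a := by
    intro hv
    exact h.cl1 hp (u := v) (v := p) (by tauto) (by tauto) hl.s23
  obtain ⟨h1, h2, h3, h4, n1, n2, n3, n4⟩ := h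
  by_cases c1 : p ≠ x ∧ p ≠ y ∧ v ≠ x ∧ v ≠ y
  · exact hp.p7 hg hl.rot h3 (by grind)
  by_cases c2 : p ≠ z ∧ p ≠ w ∧ v ≠ z ∧ v ≠ w
  · exact hp.p7 hg hl.rot h4 (by grind)
  by_cases c3 : p = x
  · subst c3
    exact hp.p7 hg h3.rot h4 (by grind)
  by_cases c3 : p = y
  · subst c3
    exact hp.p7 hg h3.s13 h4 (by grind)
  by_cases c3 : p = z
  · subst c3
    exact hp.p7 hg h4.rot h3 (by grind)
  by_cases c3 : p = w
  · subst c3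
    exact hp.p7 hg h4.s13 h3 (by grind)
  grind

lemma Cfg.star (h : Cfg H a b c d x y z w) (hp : PF H) {u p q v : α}
    (hn : u ≠ p ∧ u ≠ q ∧ u ≠ v ∧ u ≠ d ∧ p ≠ q ∧ p ≠ v ∧ p ≠ d ∧ q ≠ v ∧ q ≠ d ∧ v ≠ d)
    (hg : T H u p q) (hl : T H d u v) : False := by
  -- order-free treatment according to which of `a b c` lie in the edge
  have A : ∀ {u p q v : α}, 
      (u ≠ p ∧ u ≠ q ∧ u ≠ v ∧ u ≠ d ∧ p ≠ q ∧ p ≠ v ∧ p ≠ d ∧ q ≠ v ∧ q ≠ d ∧ v ≠ d) →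
      T H u p q → T H d u v → (p = b ∨ q = b ∨ u = b) → (p = c ∨ q = c ∨ u = c) → False := by
    intro u p q v hn hg hl hb hc
    have n1 := h.n1
    have n2 := h.n2
    have n3 := h.n3
    by_cases ha : p = a ∨ q = a ∨ u = a
    · exact h.cl1 hp (u := u) (v := v) (by grind) (by grind) hl
    rcases hb with rfl | rfl | rfl
    · rcases hc with hc | rfl | rfl
      · grind
      · exact h.l6 hp (by grind) (by grind) hg.rot hl
      · exact h.sbc.l5 hp (by grind) (by grind) hg hl
    · rcases hc with rfl | hc | rfl
      · exact h.l6 hp (by grind) (by grind) hg.rot.s12 hl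
      · grind
      · exact h.sbc.l5 hp (by grind) (by grind) hg.s23 hl
    · rcases hc with rfl | rfl | hc
      · exact h.l5 hp (by grind) (by grind) hg hl
      · exact h.l5 hp (by grind) (by grind) hg.s23 hl
      · grind
  by_cases hb : p = b ∨ q = b ∨ u = b
  · by_cases hc : p = c ∨ q = c ∨ u = c
    · exact A hn hg hl hb hc
    · -- contains `b`, not `c`
      obtain ⟨s, t, hst, hh⟩ : ∃ s t, T H b s t ∧ s ≠ b ∧ s ≠ c ∧ s ≠ d ∧ t ≠ b ∧ t ≠ c ∧ t ≠ d ∧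
          s ≠ t := by
        rcases hb with rfl | rfl | rfl
        · exact ⟨_, _, hg.s12, by grind⟩
        · exact ⟨_, _, hg.rot2, by grind⟩
        · exact ⟨_, _, hg, by grind⟩
      by_cases ha : s = a
      · subst ha
        exact h.l1 hp (by grind) hst.s12
      by_cases ha : t = a
      · subst ha
        exact h.l1 hp (by grind) hst.rot2
      · exact h.l2 hp (by grind) (by grind) (by grind) hst
  · by_cases hc : p = c ∨ q = c ∨ u = c
    · obtain ⟨s, t, hst, hh⟩ : ∃ s t, T H c s t ∧ s ≠ b ∧ s ≠ c ∧ s ≠ d ∧ t ≠ b ∧ t ≠ c ∧ t ≠ d ∧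
          s ≠ t := by
        rcases hc with rfl | rfl | rfl
        · exact ⟨_, _, hg.s12, by grind⟩
        · exact ⟨_, _, hg.rot2, by grind⟩
        · exact ⟨_, _, hg, by grind⟩
      by_cases ha : s = a
      · subst ha
        exact h.sbc.l1 hp (by grind) hst.s12
      by_cases ha : t = a
      · subst ha
        exact h.sbc.l1 hp (by grind) hst.rot2
      · exact h.sbc.l2 hp (by grind) (by grind) (by grind) hst
    · by_cases ha : u = a
      · subst ha
        exact h.l4 hp (by grind) (by grind) (by grind) hg hl
      · exact h.l3 hp (by grind) (by grind) (by grind) (by grind) hg hl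

end

end LP

namespace LP
open Finset

variable {α : Type*} [DecidableEq α]

lemma Cfg.starS {V : Finset α} {H : Finset (Finset α)} {a b c d x y z w : α} 
    (h : Cfg H a b c d x y z w) (ht : Tri V H) (hp : PF H) :
    ∀ g ∈ H, d ∉ g → ∀ r ∈ g, ∀ s, T H d r s → s ∈ g := by
  intro g hg hd r hr s hl
  by_contra hs
  obtain ⟨p, q, h1, rfl⟩ := exT_mem ht hg hr
  have n1 := h1.ne ht
  have n2 := hl.ne ht
  simp only [mem_insert, mem_singleton] at hd hs
  exact h.star hp (by grind) h1 hl

set_option synthInstance.maxSize 1000 in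
lemma B_num : ∀ r p y : ℕ, 2 ≤ r → 6 ≤ r + y → 4 ≤ r + p → 7 ≤ r + p + y → r + p + y ≤ 14 →
    r * max (p + 1) 3 / 2 + F p + y.choose 2 ≤ B (r + p + y + 1) ∨ (r = 6 ∧ p = 6 ∧ y = 0) ∨
      (r = 4 ∧ p = 0 ∧ y = 10) := by
  have : ∀ r < 15, ∀ p < 15, ∀ y < 15, (2 ≤ r ∧ 6 ≤ r + y ∧ 4 ≤ r + p ∧ 7 ≤ r + p + y ∧
    r + p + y ≤ 14) →
    r * max (p + 1) 3 / 2 + F p + y.choose 2 ≤ B (r + p + y + 1) ∨ (r = 6 ∧ p = 6 ∧ y = 0) ∨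
      (r = 4 ∧ p = 0 ∧ y = 10) := by decide +kernel
  intro r p y h1 h2 h3 h4 h5
  exact this r (by omega) p (by omega) y (by omega) ⟨h1, h2, h3, h4, h5⟩

/-- the degree bound -/
lemma deg_R {V : Finset α} {H : Finset (Finset α)} {d : α} (ht : Tri V H) 
    (hS : ∀ g ∈ H, d ∉ g → ∀ r ∈ g, ∀ s, T H d r s → s ∈ g) {P : Finset α}
    (hP : ∀ g ∈ H, d ∉ g → ∀ v ∈ g, v ∉ P → ∃ s, T H d v s) {r : α} {g0 : Finset α} (hg0 : g0 ∈ H)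
    (hd0 : d ∉ g0) (hr0 : r ∈ g0) {r1 : α} (hr1 : T H d r r1) :
    (H.filter (fun e => r ∈ e)).card ≤ max (P.card + 1) 3 := by
  have n1 := hr1.ne ht
  by_cases h2 : ∃ r2, r2 ≠ r1 ∧ T H d r r2
  · obtain ⟨r2, h21, h2⟩ := h2
    have n2 := h2.ne ht
    have hsub : H.filter (fun e => r ∈ e) ⊆ {{r, r1, r2}, {d, r, r1}, {d, r, r2}} := by
      intro e he
      rw [mem_filter] at he
      have key : ∀ e ∈ H, d ∉ e → r ∈ e → e = {r, r1, r2} := by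
        intro e he hd hr
        have h3 := hS e he hd r hr r1 hr1
        have h4 := hS e he hd r hr r2 h2
        obtain ⟨s, h5, rfl⟩ := exT_mem2 ht he hr h3 n1.2.2
        have n3 := h5.ne ht
        simp only [mem_insert, mem_singleton] at h4
        have : s = r2 := by grind
        rw [this]
      by_cases hd : d ∈ e
      · obtain ⟨s, h5, rfl⟩ := exT_mem2 ht he.1 hd he.2 n1.1
        have h6 := hS g0 hg0 hd0 r hr0 s h5
        rw [key g0 hg0 hd0 hr0] at h6
        have n3 := h5.ne ht
        simp only [mem_insert, mem_singleton] at h6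
        rcases h6 with h6 | rfl | rfl
        · exact absurd h6.symm n3.2.2
        · simp
        · simp
      · rw [key e he.1 hd he.2]; simp
    have := (card_le_card hsub).trans card_le_three
    omega
  · push Not at h2
    by_cases h3 : ∃ q, q ∉ P ∧ T H r r1 q ∧ q ≠ d
    · obtain ⟨q, hqP, h3, hqd⟩ := h3
      have n3 := h3.ne ht
      have hd1 : d ∉ ({r, r1, q} : Finset α) := by simp; grind
      obtain ⟨s, hs⟩ := hP _ h3 hd1 q (by simp) hqP
      have hs1 := hS _ h3 hd1 q (by simp) s hs
      have n4 := hs.ne ht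
      have hsr : s ≠ r := by
        rintro rfl
        by_cases hq : q = r1
        · exact n3.2.2 hq.symm
        · exact h2 q hq hs.s23
      have hsr1 : s = r1 := by
        simp only [mem_insert, mem_singleton] at hs1
        grind
      subst hsr1
      have hsub : H.filter (fun e => r ∈ e) ⊆ {{r, s, q}, {d, r, s}} := by
        intro e he
        rw [mem_filter] at he
        by_cases hd : d ∈ e
        · obtain ⟨t, h5, rfl⟩ := exT_mem2 ht he.1 hd he.2 n1.1
          by_cases hts : t = s
          · rw [hts]; simp
          · exact absurd h5 (h2 t hts)
        · have h6 := hS e he.1 hd r he.2 s hr1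
          have h7 := hS e he.1 hd s h6 q hs.s23
          obtain ⟨t, h5, rfl⟩ := exT_mem2 ht he.1 he.2 h6 n1.2.2
          have n5 := h5.ne ht
          simp only [mem_insert, mem_singleton] at h7
          have : q = t := by grind
          rw [this]; simp
      have := (card_le_card hsub).trans card_le_two
      omega
    · push Not at h3
      have hsub : H.filter (fun e => r ∈ e) ⊆ insert {d, r, r1} (P.image (fun q => {r, r1, q})) := by
        intro e he
        rw [mem_filter] at he
        by_cases hd : d ∈ e
        · obtain ⟨t, h5, rfl⟩ := exT_mem2 ht he.1 hd he.2 n1.1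
          by_cases hts : t = r1
          · rw [hts]; simp
          · exact absurd h5 (h2 t hts)
        · have h6 := hS e he.1 hd r he.2 r1 hr1
          obtain ⟨t, h5, rfl⟩ := exT_mem2 ht he.1 he.2 h6 n1.2.2
          have h7 : t ∈ P := by
            by_contra h7
            have := h3 t h7 h5
            simp [this] at hd
          rw [mem_insert, mem_image]
          exact Or.inr ⟨t, h7, rfl⟩
      have h4 := (card_le_card hsub).trans (card_insert_le _ _)
      have h5 := card_image_le (s := P) (f := fun q => ({r, r1, q} : Finset α))
      omega

lemma sum_deg {H : Finset (Finset α)} {R : Finset α} (h : ∀ e ∈ H, 2 ≤ (e ∩ R).card) {k : ℕ}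
    (hk : ∀ r ∈ R, (H.filter (fun e => r ∈ e)).card ≤ k) : 2 * H.card ≤ R.card * k := by
  have h1 : ∑ e ∈ H, (e ∩ R).card = ∑ r ∈ R, (H.filter (fun e => r ∈ e)).card := by
    have := sum_card_bipartiteAbove_eq_sum_card_bipartiteBelow (s := H) (t := R)
      (fun e r => r ∈ e)
    simp only [bipartiteAbove, bipartiteBelow] at this
    rw [← this]
    refine sum_congr rfl fun e _ => ?_
    congr 1
    ext; simp [and_comm]
  have h2 : H.card * 2 ≤ ∑ e ∈ H, (e ∩ R).card := by
    simpa using card_nsmul_le_sum H (fun e => (e ∩ R).card) 2 h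
  have h3 : ∑ r ∈ R, (H.filter (fun e => r ∈ e)).card ≤ R.card * k := by
    simpa using sum_le_card_nsmul R _ k hk
  omega

set_option maxHeartbeats 1600000 in
lemma caseBi {n : ℕ} (hn : n ≤ 15) (ih : IH α n) {V : Finset α}
    {H : Finset (Finset α)} (hV : V.card = n) (ht : Tri V H) (hp : PF H)
    {a b c d x y z w : α} (h : Cfg H a b c d x y z w) : Concl V H := by
  classical
  by_cases hnear : Near H
  · exact Or.inl hnear
  right; left
  have hS := h.starS ht hp
  set G := H.filter (fun e => d ∉ e) with hG
  set U := G.biUnion id with hU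
  set R := U.filter (fun v => ∃ s, T H d v s) with hR
  set P := U.filter (fun v => ¬ ∃ s, T H d v s) with hPd
  set Y := (V.erase d) \ U with hY
  have mU : ∀ v, v ∈ U ↔ ∃ g ∈ H, d ∉ g ∧ v ∈ g := by
    intro v
    simp only [hU, hG, mem_biUnion, mem_filter, id]
    constructor
    · rintro ⟨g, ⟨h1, h2⟩, h3⟩; exact ⟨g, h1, h2, h3⟩
    · rintro ⟨g, h1, h2, h3⟩; exact ⟨g, ⟨h1, h2⟩, h3⟩
  have mR : ∀ v, v ∈ R ↔ v ∈ U ∧ ∃ s, T H d v s := fun v => by rw [hR, mem_filter]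
  have mP : ∀ v, v ∈ P ↔ v ∈ U ∧ ¬ ∃ s, T H d v s := fun v => by rw [hPd, mem_filter]
  have hUV : U ⊆ V.erase d := by
    intro v hv
    obtain ⟨g, h1, h2, h3⟩ := (mU v).1 hv
    exact mem_erase.2 ⟨fun h => h2 (h ▸ h3), (ht g h1).1 h3⟩
  have hdV : d ∈ V := (h.dxy.mem ht).1
  have c1 : R.card + P.card = U.card := card_filter_add_card_filter_not _
  have c2 : U.card + Y.card + 1 = n := by
    rw [hY, card_sdiff_of_subset hUV, card_erase_of_mem hdV, hV]
    have := card_le_card hUV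
    rw [card_erase_of_mem hdV, hV] at this
    have : 0 < V.card := card_pos.2 ⟨d, hdV⟩
    omega
  have hG2 : 2 ≤ G.card := by
    by_contra hh
    exact hnear ⟨d, by rw [← hG]; omega⟩
  have hU4 : 4 ≤ U.card := by
    by_contra hh
    have : G ⊆ powersetCard 3 U := fun g hg => by
      rw [mem_powersetCard]
      refine ⟨fun v hv => mem_biUnion.2 ⟨g, hg, hv⟩, (ht g (mem_filter.1 hg).1).2⟩
    have := card_le_card this
    rw [card_powersetCard] at this
    have h4 : U.card ≤ 3 := by omega
    have : U.card.choose 3 ≤ 1 := by interval_cases U.card <;> decide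
    omega
  have n1 := h.n1
  have n2 := h.n2
  have n3 := h.n3
  have n4 := h.n4
  have hR2 : 2 ≤ R.card := by
    have : ({b, c} : Finset α) ⊆ R := by
      intro v hv
      simp only [mem_insert, mem_singleton] at hv
      rw [mR, mU]
      have hd : d ∉ ({a, b, c} : Finset α) := by simp; grind
      rcases hv with rfl | rfl
      · exact ⟨⟨_, h.abc, hd, by simp⟩, _, h.bcd.rot2⟩
      · exact ⟨⟨_, h.abc, hd, by simp⟩, _, h.bcd.s13⟩
    have := card_le_card this
    rwa [card_pair n2.1] at this
  have hRY : 6 ≤ R.card + Y.card := by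
    have : ({b, c, x, y, z, w} : Finset α) ⊆ R ∪ Y := by
      have key : ∀ v s, T H d v s → v ∈ R ∪ Y := by
        intro v s hvs
        rw [mem_union, mR, hY, mem_sdiff, mem_erase]
        by_cases hv : v ∈ U
        · exact Or.inl ⟨hv, s, hvs⟩
        · exact Or.inr ⟨⟨(hvs.ne ht).1.symm, (hvs.mem ht).2.1⟩, hv⟩
      intro v hv
      simp only [mem_insert, mem_singleton] at hv
      rcases hv with rfl | rfl | rfl | rfl | rfl | rfl
      · exact key _ _ h.bcd.rot2
      · exact key _ _ h.bcd.s13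
      · exact key _ _ h.dxy
      · exact key _ _ h.dxy.s23
      · exact key _ _ h.dzw
      · exact key _ _ h.dzw.s23
    have h6 : ({b, c, x, y, z, w} : Finset α).card = 6 := by
      repeat rw [card_insert_of_notMem (by simp; grind)]
      simp
    have := (card_le_card this).trans (card_union_le _ _)
    omega
  -- the three classes
  set E := H.filter (fun e => ¬ Disjoint e R) with hE
  set D := powersetCard 2 Y with hD
  have hEtwo : ∀ e ∈ E, e ⊆ insert d (R ∪ P) ∧ (∀ v ∈ e, d ∈ e → v = d ∨ v ∈ R) ∧
      2 ≤ (e ∩ R).card := by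
    intro e he
    rw [hE, mem_filter, not_disjoint_iff] at he
    obtain ⟨he, r, hre, hrR⟩ := he
    obtain ⟨hrU, s, hrs⟩ := (mR r).1 hrR
    have hss := hrs.ne ht
    by_cases hd : d ∈ e
    · obtain ⟨t, h5, rfl⟩ := exT_mem2 ht he hd hre hss.1
      obtain ⟨g, h1, h2, h3⟩ := (mU r).1 hrU
      have h4 := hS g h1 h2 r h3 t h5
      have htR : t ∈ R := (mR t).2 ⟨(mU t).2 ⟨g, h1, h2, h4⟩, r, h5.s23⟩
      refine ⟨?_, ?_, ?_⟩
      · intro v hv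
        simp only [mem_insert, mem_singleton, mem_union] at hv ⊢
        rcases hv with rfl | rfl | rfl <;> tauto
      · intro v hv _
        simp only [mem_insert, mem_singleton] at hv
        rcases hv with rfl | rfl | rfl <;> tauto
      · have : ({r, t} : Finset α) ⊆ {d, r, t} ∩ R := by
          intro v hv
          simp only [mem_insert, mem_singleton] at hv
          rcases hv with rfl | rfl
          · exact mem_inter.2 ⟨by simp, hrR⟩
          · exact mem_inter.2 ⟨by simp, htR⟩
        have := card_le_card this
        rwa [card_pair (h5.ne ht).2.2] at this
    · have h4 := hS e he hd r hre s hrs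
      have hsR : s ∈ R := (mR s).2 ⟨(mU s).2 ⟨e, he, hd, h4⟩, r, hrs.s23⟩
      refine ⟨?_, fun _ _ h => absurd h hd, ?_⟩
      · intro v hv
        have hvU : v ∈ U := (mU v).2 ⟨e, he, hd, hv⟩
        simp only [mem_insert, mem_union, mR, mP]
        tauto
      · have : ({r, s} : Finset α) ⊆ e ∩ R := by
          intro v hv
          simp only [mem_insert, mem_singleton] at hv
          rcases hv with rfl | rfl
          · exact mem_inter.2 ⟨hre, hrR⟩
          · exact mem_inter.2 ⟨h4, hsR⟩
        have := card_le_card this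
        rwa [card_pair hss.2.2] at this
  have hcov : H ⊆ E ∪ (res H P ∪ D.image (insert d)) := by
    intro e he
    rw [mem_union, mem_union]
    by_cases hdis : Disjoint e R
    · right
      by_cases hd : d ∈ e
      · right
        obtain ⟨p, q, h5, rfl⟩ := exT_mem ht he hd
        have n5 := h5.ne ht
        have key : ∀ p q, T H d p q → p ∉ R → p ∈ Y := by
          intro p q hpq hpR
          rw [hY, mem_sdiff, mem_erase]
          refine ⟨⟨(hpq.ne ht).1.symm, (hpq.mem ht).2.1⟩, fun h => hpR ((mR p).2 ⟨h, q, hpq⟩)⟩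
        rw [mem_image]
        refine ⟨{p, q}, ?_, rfl⟩
        rw [hD, mem_powersetCard]
        refine ⟨?_, card_pair n5.2.2⟩
        intro v hv
        simp only [mem_insert, mem_singleton] at hv
        have hvR : v ∉ R := disjoint_left.1 hdis (by simp; tauto)
        rcases hv with rfl | rfl
        · exact key _ _ h5 hvR
        · exact key _ _ h5.s23 hvR
      · left
        rw [res, mem_filter]
        refine ⟨he, fun v hv => ?_⟩
        have hvU : v ∈ U := (mU v).2 ⟨e, he, hd, hv⟩
        have hvR := disjoint_left.1 hdis hv
        rw [mP]
        rw [mR] at hvR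
        tauto
    · exact Or.inl (mem_filter.2 ⟨he, hdis⟩)
  have cP : (res H P).card ≤ F P.card :=
    card_le_F hn ih (by omega) (ht.res P) (hp.res P)
  have cD : (D.image (insert d)).card ≤ Y.card.choose 2 := by
    refine card_image_le.trans ?_
    rw [hD, card_powersetCard]
  have hcard : H.card ≤ E.card + ((res H P).card + (D.image (insert d)).card) := by
    refine (card_le_card hcov).trans ((card_union_le _ _).trans ?_)
    have := card_union_le (res H P) (D.image (insert d))
    omega
  have cE : 2 * E.card ≤ R.card * max (P.card + 1) 3 := by
    refine sum_deg (fun e he => (hEtwo e he).2.2) fun r hr => ?_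
    obtain ⟨hrU, s, hrs⟩ := (mR r).1 hr
    obtain ⟨g, h1, h2, h3⟩ := (mU r).1 hrU
    refine le_trans (card_le_card ?_) (deg_R ht hS (P := P) ?_ h1 h2 h3 hrs)
    · exact filter_subset_filter _ (filter_subset _ _)
    · intro g hg hd v hv hvP
      by_contra hh
      exact hvP ((mP v).2 ⟨(mU v).2 ⟨g, hg, hd, hv⟩, hh⟩)
  have cE2 : E.card ≤ R.card * max (P.card + 1) 3 / 2 := by omega
  have hbn := B_num R.card P.card Y.card hR2 hRY (by omega) (by
    have h7 : ({a, b, c, x, y, z, w} : Finset α).card = 7 := by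
      repeat rw [card_insert_of_notMem (by simp; grind)]
      simp
    have hs : ({a, b, c, x, y, z, w} : Finset α) ⊆ V.erase d := by
      have m1 := h.abc.mem ht
      have m2 := h.dxy.mem ht
      have m3 := h.dzw.mem ht
      intro v hv
      simp only [mem_insert, mem_singleton] at hv
      rw [mem_erase]
      rcases hv with rfl | rfl | rfl | rfl | rfl | rfl | rfl
      · exact ⟨n1.2.2.1, m1.1⟩
      · exact ⟨n2.2.1, m1.2.1⟩
      · exact ⟨n3.1, m1.2.2⟩
      · exact ⟨n4.1.symm, m2.2.1⟩
      · exact ⟨n4.2.1.symm, m2.2.2⟩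
      · exact ⟨n4.2.2.1.symm, m3.2.1⟩
      · exact ⟨n4.2.2.2.1.symm, m3.2.2⟩
    have := card_le_card hs
    rw [card_erase_of_mem hdV] at this
    omega) (by omega)
  have hVn : V.card = R.card + P.card + Y.card + 1 := by omega
  rcases hbn with hb | ⟨e1, e2, e3⟩ | ⟨e1, e2, e3⟩
  · rw [hVn]; omega
  · rw [hVn, e1, e2, e3]
    by_contra hbig
    have hB : B (6 + 6 + 0 + 1) = 40 := by decide
    rw [hB] at hbig
    rw [e1, e2] at cE2
    have hF : F 6 = 20 := by decide
    rw [e2, hF] at cP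
    rw [e3] at cD
    norm_num at cD cE2
    have cD0 : (D.image (insert d)).card = 0 := by
      rw [hD, card_eq_zero, image_eq_empty, powersetCard_eq_empty]
      omega
    have e4 : (res H P).card = 20 := by omega
    have e5 : E.card = 21 := by omega
    have hfull : res H P = powersetCard 3 P := by
      refine eq_of_subset_of_card_le (fun e he => mem_powersetCard.2 (ht.res P e he)) ?_
      rw [card_powersetCard, e2, e4]; decide
    by_cases hall : ∀ e ∈ E, Disjoint e P
    · have hE7 : Tri (insert d R) E := by
        intro e he
        refine ⟨fun v hv => ?_, (ht e (mem_filter.1 he).1).2⟩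
        have := (hEtwo e he).1 hv
        have h2 := disjoint_left.1 (hall e he) hv
        simp only [mem_insert, mem_union] at this ⊢
        tauto
      have hc7 : (insert d R).card ≤ 7 := by
        have := card_insert_le d R
        omega
      have h20 := card_le_F hn ih (by omega) hE7 (hp.mono (filter_subset _ _))
      have : ∀ k ≤ 7, F k ≤ 20 := by decide
      have := this _ hc7
      omega
    · push Not at hall
      obtain ⟨e, heE, hedis⟩ := hall
      obtain ⟨q, hqe, hqP⟩ := not_disjoint_iff.1 hedis
      have h1 := hEtwo e heE
      have hde : d ∉ e := by
        intro hde
        have := h1.2.1 q hqe hde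
        rcases this with rfl | h
        · exact (mem_erase.1 (hUV ((mP q).1 hqP).1)).1 rfl
        · exact ((mP q).1 hqP).2 ((mR q).1 h).2
      have heH : e ∈ H := (mem_filter.1 heE).1
      have hRP : Disjoint R P := disjoint_filter_filter_not _ _ _
      have heP : ∀ v ∈ e, v ∈ P → v = q := by
        by_contra hh
        push Not at hh
        obtain ⟨v, hv, hvP, hvq⟩ := hh
        have : e ∩ R ⊆ (e.erase q).erase v := by
          intro t ht
          rw [mem_inter] at ht
          rw [mem_erase, mem_erase]
          refine ⟨?_, ?_, ht.1⟩
          · rintro rfl; exact disjoint_left.1 hRP ht.2 hvP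
          · rintro rfl; exact disjoint_left.1 hRP ht.2 hqP
        have := card_le_card this
        rw [card_erase_of_mem (mem_erase.2 ⟨hvq, hv⟩), card_erase_of_mem hqe, (ht e heH).2] at this
        have := h1.2.2
        omega
      have h5 : 4 ≤ (P.erase q).card := by rw [card_erase_of_mem hqP]; omega
      obtain ⟨Q, hQ, hQ4⟩ := exists_subset_card_eq h5
      obtain ⟨s, t, u, v, k1, k2, k3, k4, k5, k6, rfl⟩ := card_eq_four.1 hQ4
      have hm : ∀ i ∈ ({s, t, u, v} : Finset α), i ∈ P ∧ i ≠ q := by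
        intro i hi
        have := mem_erase.1 (hQ hi)
        exact ⟨this.2, this.1⟩
      have ms := hm s (by simp)
      have mt := hm t (by simp)
      have mu := hm u (by simp)
      have mv := hm v (by simp)
      have T1 : T H q s t := by
        have : ({q, s, t} : Finset α) ∈ res H P := by
          rw [hfull, mem_powersetCard]
          refine ⟨?_, card_eq_three.2 ⟨q, s, t, ms.2.symm, mt.2.symm, k1, rfl⟩⟩
          intro i hi
          simp only [mem_insert, mem_singleton] at hi
          grind
        exact res_sub _ _ this
      have T2 : T H t u v := by
        have : ({t, u, v} : Finset α) ∈ res H P := by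
          rw [hfull, mem_powersetCard]
          refine ⟨?_, card_eq_three.2 ⟨t, u, v, k4, k5, k6, rfl⟩⟩
          intro i hi
          simp only [mem_insert, mem_singleton] at hi
          grind
        exact res_sub _ _ this
      obtain ⟨i, j, hij, rfl⟩ := exT_mem ht heH hqe
      have hi := heP i (by simp)
      have hj := heP j (by simp)
      have nij := hij.ne ht
      exact hp.p7 hij.rot T1 T2 (by grind)
  · exfalso
    -- no isolated vertices and `U` has four elements
    have hP0 : P = ∅ := card_eq_zero.1 e2
    have hU4' : U.card = 4 := by omega
    obtain ⟨g, hg, g', hg', hgg⟩ := one_lt_card.1 (by omega : 1 < G.card)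
    rw [hG, mem_filter] at hg hg'
    have hsub : g ∪ g' ⊆ U := by
      intro v hv
      rw [mem_union] at hv
      rw [mU]
      rcases hv with hv | hv
      · exact ⟨g, hg.1, hg.2, hv⟩
      · exact ⟨g', hg'.1, hg'.2, hv⟩
    have c3 := card_le_card hsub
    have c4 := card_sdiff_add_card g g'
    have c5 := (ht g' hg'.1).2
    have c6 := (ht g hg.1).2
    have c7 : (g \ g').card ≤ 1 := by omega
    have : ¬ g ⊆ g' := fun hh => hgg (eq_of_subset_of_card_le hh (by omega))
    obtain ⟨s, hs, hs'⟩ := not_subset.1 this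
    have hsU : s ∈ U := (mU s).2 ⟨g, hg.1, hg.2, hs⟩
    have hsP : s ∉ P := by rw [hP0]; simp
    rw [mP] at hsP
    obtain ⟨t, hst⟩ : ∃ t, T H d s t := by
      by_contra hh; exact hsP ⟨hsU, hh⟩
    have htg := hS g hg.1 hg.2 s hs t hst
    have htg' : t ∈ g' := by
      by_contra hh
      exact (hst.ne ht).2.2 (card_le_one.1 c7 s (mem_sdiff.2 ⟨hs, hs'⟩) t (mem_sdiff.2 ⟨htg, hh⟩))
    exact hs' (hS g' hg'.1 hg'.2 t htg' s hst.s23)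

end LP

namespace LP
open Finset

variable {α : Type*} [DecidableEq α]

abbrev Out (a b c d x y w : α) : Prop := w ≠ a ∧ w ≠ b ∧ w ≠ c ∧ w ≠ d ∧ w ≠ x ∧ w ≠ y

structure Q (H : Finset (Finset α)) (a b c d x y : α) : Prop where
  abc : T H a b c
  bcd : T H b c d
  dxy : T H d x y
  n1 : a ≠ b ∧ a ≠ c ∧ a ≠ d ∧ a ≠ x ∧ a ≠ y
  n2 : b ≠ c ∧ b ≠ d ∧ b ≠ x ∧ b ≠ y
  n3 : c ≠ d ∧ c ≠ x ∧ c ≠ y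
  n4 : d ≠ x ∧ d ≠ y ∧ x ≠ y

def NoCfg (H : Finset (Finset α)) : Prop := ∀ a b c d x y z w, ¬ Cfg H a b c d x y z w

section
variable {H : Finset (Finset α)} {a b c d x y : α}

lemma Q.no1 (h : Q H a b c d x y) (hp : PF H) {w p q : α} (hw : Out a b c d x y w)
    (ht : T H w p q) (h1 : p = a ∨ p = b ∨ p = c) (h2 : q = d ∨ q = x ∨ q = y) : False := by
  obtain ⟨e1, e2, e3, n1, n2, n3, n4⟩ := h
  obtain ⟨s, t, k1, k2⟩ : ∃ s t, T H s t p ∧ ((s = b ∧ t = c ∧ p = a) ∨ (s = a ∧ t = c ∧ p = b) ∨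
      (s = a ∧ t = b ∧ p = c)) := by
    rcases h1 with rfl | rfl | rfl
    · exact ⟨_, _, e1.rot, by simp⟩
    · exact ⟨_, _, e1.s23, by simp⟩
    · exact ⟨_, _, e1, by simp⟩
  obtain ⟨u, v, k3, k4⟩ : ∃ u v, T H q u v ∧ ((q = d ∧ u = x ∧ v = y) ∨ (q = x ∧ u = d ∧ v = y) ∨
      (q = y ∧ u = d ∧ v = x)) := by
    rcases h2 with rfl | rfl | rfl
    · exact ⟨_, _, e3, by simp⟩
    · exact ⟨_, _, e3.s12, by simp⟩
    · exact ⟨_, _, e3.rot2, by simp⟩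
  clear h1 h2
  rcases k2 with ⟨rfl, rfl, rfl⟩ | ⟨rfl, rfl, rfl⟩ | ⟨rfl, rfl, rfl⟩ <;>
  rcases k4 with ⟨rfl, rfl, rfl⟩ | ⟨rfl, rfl, rfl⟩ | ⟨rfl, rfl, rfl⟩ <;>
  exact hp.p7 k1 ht.s12 k3 (by grind)

lemma Q.no2 (h : Q H a b c d x y) (hp : PF H) {p q r : α} (hr : r = b ∨ r = c) (ht : T H r p q)
    (h1 : p ≠ b ∧ p ≠ c ∧ p ≠ d ∧ p ≠ x ∧ p ≠ y) (h2 : q ≠ b ∧ q ≠ c ∧ q ≠ d ∧ q ≠ x ∧ q ≠ y) :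
    False := by
  obtain ⟨e1, e2, e3, n1, n2, n3, n4⟩ := h
  rcases hr with rfl | rfl
  · exact hp.p7 ht.rot e2 e3 (by grind)
  · exact hp.p7 ht.rot e2.s12 e3 (by grind)

lemma Q.no3 (h : Q H a b c d x y) (hp : PF H) {p q r : α} (hr : r = x ∨ r = y) (ht : T H r p q)
    (h1 : Out a b c d x y p) (h2 : Out a b c d x y q) :
    False := by
  obtain ⟨e1, e2, e3, n1, n2, n3, n4⟩ := h
  rcases hr with rfl | rfl
  · exact hp.p7 ht.rot e3.rot e2.rot2 (by grind)
  · exact hp.p7 ht.rot e3.s13 e2.rot2 (by grind)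

lemma Q.no4 (h : Q H a b c d x y) (hN : NoCfg H) {p q : α} (ht : T H d p q) (hpq : p ≠ q)
    (h1 : Out a b c d x y p) (h2 : Out a b c d x y q) :
    False := by
  obtain ⟨e1, e2, e3, n1, n2, n3, n4⟩ := h
  exact hN a b c d x y p q ⟨e1, e2, e3, ht, by grind, by grind, by grind, by grind⟩

set_option maxHeartbeats 800000 in
lemma Q.types (h : Q H a b c d x y) (hp : PF H) (hN : NoCfg H) {w p q : α}
    (hw : Out a b c d x y w) (ht : T H w p q) (hne : w ≠ p ∧ w ≠ q ∧ p ≠ q) :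
    (Out a b c d x y p ∧ Out a b c d x y q) ∨ (p = a ∧ Out a b c d x y q) ∨
    (q = a ∧ Out a b c d x y p) ∨ (p = b ∧ q = c) ∨ (p = c ∧ q = b) ∨ (p = x ∧ q = y) ∨
    (p = y ∧ q = x) ∨ (p = d ∧ q = x) ∨ (p = x ∧ q = d) ∨ (p = d ∧ q = y) ∨ (p = y ∧ q = d) := by
  have k1 := h.no1 hp hw ht
  have k1' := h.no1 hp hw ht.s23
  have k2 : p = b ∨ p = c → (q ≠ b ∧ q ≠ c ∧ q ≠ d ∧ q ≠ x ∧ q ≠ y) → False := fun hr h2 =>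
    h.no2 hp hr ht.s12 (by tauto) h2
  have k2' : q = b ∨ q = c → (p ≠ b ∧ p ≠ c ∧ p ≠ d ∧ p ≠ x ∧ p ≠ y) → False := fun hr h2 =>
    h.no2 hp hr ht.rot2 (by tauto) h2
  have k3 : p = x ∨ p = y → Out a b c d x y q → False := fun hr h2 =>
    h.no3 hp hr ht.s12 hw h2
  have k3' : q = x ∨ q = y → Out a b c d x y p → False := fun hr h2 =>
    h.no3 hp hr ht.rot2 hw h2
  have k4 : p = d → Out a b c d x y q → False := fun hr h2 =>
    h.no4 hN (by rw [← hr]; exact ht.s12) hne.2.1 hw h2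
  have k4' : q = d → Out a b c d x y p → False := fun hr h2 =>
    h.no4 hN (by rw [← hr]; exact ht.rot2) hne.1 hw h2
  have o : ∀ p, (p = a ∨ p = b ∨ p = c) ∨ (p = d ∨ p = x ∨ p = y) ∨ Out a b c d x y p := by
    intro p
    by_cases h1 : p = a ∨ p = b ∨ p = c
    · exact Or.inl h1
    by_cases h2 : p = d ∨ p = x ∨ p = y
    · exact Or.inr (Or.inl h2)
    simp only [not_or] at h1 h2
    exact Or.inr (Or.inr ⟨h1.1, h1.2.1, h1.2.2, h2.1, h2.2.1, h2.2.2⟩)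
  rcases o p with hP | hP | hP
  · rcases o q with hq | hq | hq
    · have n1 := h.n1
      have n2 := h.n2
      have n3 := h.n3
      clear k1 k1' k3 k3' k4 k4'
      grind
    · exact (k1 hP hq).elim
    · clear k1 k1' k3 k3' k4 k4'
      grind
  · rcases o q with hq | hq | hq
    · exact (k1' hq hP).elim
    · clear k1 k1' k2 k2' k3 k3' k4 k4'
      have n4 := h.n4
      grind
    · clear k1 k1' k2 k2'
      grind
  · rcases o q with hq | hq | hq
    · clear k1 k1' k3 k3' k4 k4'
      grind
    · clear k1 k1' k2 k2'
      grind
    · exact Or.inl ⟨hP, hq⟩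

lemma Q.edge (h : Q H a b c d x y) {V : Finset α} (hT : Tri V H) (hp : PF H) (hN : NoCfg H) {w : α}
    (hw : Out a b c d x y w) {e : Finset α} (he : e ∈ H) (hwe : w ∈ e) :
    (∃ p q, T H w p q ∧ e = {w, p, q} ∧ Out a b c d x y p ∧ Out a b c d x y q) ∨
    (∃ q, T H a w q ∧ e = {a, w, q} ∧ Out a b c d x y q) ∨
    (T H b c w ∧ e = {b, c, w}) ∨ (T H x y w ∧ e = {x, y, w}) ∨ (T H d x w ∧ e = {d, x, w}) ∨
    (T H d y w ∧ e = {d, y, w}) := by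
  obtain ⟨p, q, h1, rfl⟩ := exT_mem hT he hwe
  have e1 : ({w, p, q} : Finset α) = {p, q, w} := by ext; simp; tauto
  have e2 : ({w, p, q} : Finset α) = {q, p, w} := by ext; simp; tauto
  rcases h.types hp hN hw h1 (h1.ne hT) with k | k | k | k | k | k | k | k | k | k | k
  · exact Or.inl ⟨p, q, h1, rfl, k⟩
  · obtain ⟨rfl, k⟩ := k
    exact Or.inr (Or.inl ⟨q, h1.s12, by rw [Finset.insert_comm], k⟩)
  · obtain ⟨rfl, k⟩ := k
    exact Or.inr (Or.inl ⟨p, h1.rot2, by rw [e2]; ext; simp; tauto, k⟩)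
  all_goals obtain ⟨rfl, rfl⟩ := k
  · exact Or.inr (Or.inr (Or.inl ⟨h1.rot, e1⟩))
  · exact Or.inr (Or.inr (Or.inl ⟨h1.s13, e2⟩))
  · exact Or.inr (Or.inr (Or.inr (Or.inl ⟨h1.rot, e1⟩)))
  · exact Or.inr (Or.inr (Or.inr (Or.inl ⟨h1.s13, e2⟩)))
  · exact Or.inr (Or.inr (Or.inr (Or.inr (Or.inl ⟨h1.rot, e1⟩))))
  · exact Or.inr (Or.inr (Or.inr (Or.inr (Or.inl ⟨h1.s13, e2⟩))))
  · exact Or.inr (Or.inr (Or.inr (Or.inr (Or.inr ⟨h1.rot, e1⟩))))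
  · exact Or.inr (Or.inr (Or.inr (Or.inr (Or.inr ⟨h1.s13, e2⟩))))

/-! mutual exclusions -/

lemma Q.a_xy (h : Q H a b c d x y) (hp : PF H) {w w' : α} (hw : Out a b c d x y w)
    (hw' : Out a b c d x y w') (hne : w ≠ w') (h1 : T H a w w') : ¬ T H x y w ∧ ¬ T H d x w ∧
    ¬ T H d y w := by
  obtain ⟨e1, e2, e3, n1, n2, n3, n4⟩ := h
  refine ⟨fun h2 => ?_, fun h2 => ?_, fun h2 => ?_⟩
  · exact hp.p7 e1.rot h1.s23 h2.rot2 (by grind)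
  · exact hp.p7 e1.rot h1.s23 h2.rot2 (by grind)
  · exact hp.p7 e1.rot h1.s23 h2.rot2 (by grind)

lemma Q.www_d (h : Q H a b c d x y) (hp : PF H) {w p q : α} (hw : Out a b c d x y w)
    (hP : Out a b c d x y p) (hq : Out a b c d x y q) (hne : w ≠ p ∧ w ≠ q ∧ p ≠ q)
    (h1 : T H w p q) : ¬ T H d x w ∧ ¬ T H d y w := by
  obtain ⟨e1, e2, e3, n1, n2, n3, n4⟩ := h
  refine ⟨fun h2 => ?_, fun h2 => ?_⟩
  · exact hp.p7 e2 h2 h1 (by grind)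
  · exact hp.p7 e2 h2 h1 (by grind)

end

end LP

namespace LP
open Finset

variable {α : Type*} [DecidableEq α]

abbrev U6 (a b c d x y : α) : Finset α := {a, b, c, d, x, y}

lemma not_mem_U6 {a b c d x y w : α} : w ∉ U6 a b c d x y ↔ Out a b c d x y w := by
  simp only [U6, mem_insert, mem_singleton, not_or]

/-- triples `{z} ∪ {m} ∪ {n}` -/
def tri (z : α) (M N : Finset α) : Finset (Finset α) :=
  (M ×ˢ N).image (fun p => {z, p.1, p.2})

lemma mem_tri {z : α} {M N : Finset α} {e : Finset α} :
    e ∈ tri z M N ↔ ∃ m ∈ M, ∃ n ∈ N, e = {z, m, n} := by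
  simp only [tri, mem_image, mem_product, Prod.exists]
  constructor
  · rintro ⟨m, n, ⟨h1, h2⟩, rfl⟩; exact ⟨m, h1, n, h2, rfl⟩
  · rintro ⟨m, h1, n, h2, rfl⟩; exact ⟨m, n, ⟨h1, h2⟩, rfl⟩

lemma card_tri {z : α} {M N : Finset α} (h1 : z ∉ M) (h2 : z ∉ N) (h3 : Disjoint M N) :
    (tri z M N).card = M.card * N.card := by
  rw [tri, card_image_of_injOn, card_product]
  rintro ⟨m, n⟩ hm ⟨m', n'⟩ hm' he
  simp only [coe_product, Set.mem_prod, mem_coe] at hm hm' he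
  have hd : ∀ t, t ∈ M → t ∉ N := fun t h => disjoint_left.1 h3 h
  have e1 : m ∈ ({z, m', n'} : Finset α) := by rw [← he]; simp
  have e2 : n ∈ ({z, m', n'} : Finset α) := by rw [← he]; simp
  simp only [mem_insert, mem_singleton] at e1 e2
  grind

lemma tri_sub {z : α} {M N U : Finset α} (h1 : z ∉ M) (h2 : z ∉ N) (h3 : Disjoint M N)
    (hz : z ∈ U) (hM : M ⊆ U) (hN : N ⊆ U) : tri z M N ⊆ powersetCard 3 U := by
  intro e he
  obtain ⟨m, hm, n, hn, rfl⟩ := mem_tri.1 he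
  rw [mem_powersetCard]
  refine ⟨?_, card_eq_three.2 ⟨z, m, n, ?_, ?_, ?_, rfl⟩⟩
  · intro t ht
    simp only [mem_insert, mem_singleton] at ht
    rcases ht with rfl | rfl | rfl
    · exact hz
    · exact hM hm
    · exact hN hn
  · rintro rfl; exact h1 hm
  · rintro rfl; exact h2 hn
  · rintro rfl; exact disjoint_left.1 h3 hm hn

lemma res_le {V U : Finset α} {H F : Finset (Finset α)} (ht : Tri V H) (hU : U.card = 6)
    (hF : F ⊆ powersetCard 3 U) (hd : ∀ e ∈ F, e ∉ H) : (res H U).card + F.card ≤ 20 := by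
  have hdis : Disjoint (res H U) F := by
    rw [disjoint_left]
    intro e h1 h2
    exact hd e h2 (res_sub _ _ h1)
  have h2 : res H U ∪ F ⊆ powersetCard 3 U := union_subset
    (fun e he => mem_powersetCard.2 (ht.res U e he)) hF
  have := card_le_card h2
  rw [card_union_of_disjoint hdis, card_powersetCard, hU] at this
  have h20 : Nat.choose 6 3 = 20 := by decide
  omega

/-- two disjoint edges and a triple meeting each in one vertex -/
lemma PF.mid {H : Finset (Finset α)} (hp : PF H) {a b c d e f z : α} (h1 : T H a b c)
    (h2 : T H d e f) (h3 : T H a d z) (hn1 : a ≠ d ∧ a ≠ e ∧ a ≠ f ∧ a ≠ b ∧ a ≠ c ∧ a ≠ z)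
    (hn2 : b ≠ d ∧ b ≠ e ∧ b ≠ f ∧ b ≠ z ∧ c ≠ d ∧ c ≠ e ∧ c ≠ f ∧ c ≠ z)
    (hn3 : d ≠ e ∧ d ≠ f ∧ d ≠ z ∧ e ≠ z ∧ f ≠ z) : False :=
  hp.p7 h1.rot h3.s23 h2 (by grind)

section
variable {V : Finset α} {H : Finset (Finset α)} {a b c d x y : α}

lemma Q.card_U (h : Q H a b c d x y) : (U6 a b c d x y).card = 6 := by
  obtain ⟨-, -, -, n1, n2, n3, n4⟩ := h
  rw [U6]
  repeat rw [card_insert_of_notMem (by simp; grind)]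
  simp

lemma Q.sub_U (h : Q H a b c d x y) (ht : Tri V H) : U6 a b c d x y ⊆ V := by
  have m1 := h.abc.mem ht
  have m2 := h.dxy.mem ht
  intro v hv
  simp only [U6, mem_insert, mem_singleton] at hv
  rcases hv with rfl | rfl | rfl | rfl | rfl | rfl
  exacts [m1.1, m1.2.1, m1.2.2, m2.1, m2.2.1, m2.2.2]

set_option maxHeartbeats 2000000 in
lemma Q.f_bc (h : Q H a b c d x y) (ht : Tri V H) (hp : PF H) {w : α} (hw : Out a b c d x y w)
    (h1 : T H b c w) : (res H (U6 a b c d x y)).card ≤ 14 := by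
  have hU := h.card_U
  obtain ⟨e1, e2, e3, n1, n2, n3, n4⟩ := h
  have k1 : a ∉ ({b, c} : Finset α) := by simp; grind
  have k2 : a ∉ ({d, x, y} : Finset α) := by simp; grind
  have k3 : Disjoint ({b, c} : Finset α) {d, x, y} := by
    rw [disjoint_left]; simp; grind
  have c1 := card_tri k1 k2 k3
  rw [card_pair n2.1, card_eq_three.2 ⟨d, x, y, n4.1, n4.2.1, n4.2.2, rfl⟩] at c1
  have := res_le ht hU (tri_sub k1 k2 k3 (by simp) (by intro t; simp; tauto) (by intro t; simp; tauto))
    (by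
      intro e he heH
      obtain ⟨m, hm, n, hn, rfl⟩ := mem_tri.1 he
      have heH : T H a m n := heH
      simp only [mem_insert, mem_singleton] at hm hn
      rcases hm with rfl | rfl <;> rcases hn with rfl | rfl | rfl
      · exact hp.mid h1 e3 heH.rot (by grind) (by grind) (by grind)
      · exact hp.mid h1 e3.s12 heH.rot (by grind) (by grind) (by grind)
      · exact hp.mid h1 e3.rot2 heH.rot (by grind) (by grind) (by grind)
      · exact hp.mid h1.s12 e3 heH.rot (by grind) (by grind) (by grind)
      · exact hp.mid h1.s12 e3.s12 heH.rot (by grind) (by grind) (by grind)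
      · exact hp.mid h1.s12 e3.rot2 heH.rot (by grind) (by grind) (by grind))
  omega

set_option maxHeartbeats 2000000 in
lemma Q.f_a (h : Q H a b c d x y) (ht : Tri V H) (hp : PF H) {w w' : α} (hw : Out a b c d x y w)
    (hw' : Out a b c d x y w') (hne : w ≠ w')
    (h1 : T H a w w') : (res H (U6 a b c d x y)).card ≤ 14 := by
  have hU := h.card_U
  obtain ⟨e1, e2, e3, n1, n2, n3, n4⟩ := h
  have k1 : a ∉ ({b, c} : Finset α) := by simp; grind
  have k2 : a ∉ ({d, x, y} : Finset α) := by simp; grind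
  have k3 : Disjoint ({b, c} : Finset α) {d, x, y} := by
    rw [disjoint_left]; simp; grind
  have c1 := card_tri k1 k2 k3
  rw [card_pair n2.1, card_eq_three.2 ⟨d, x, y, n4.1, n4.2.1, n4.2.2, rfl⟩] at c1
  have := res_le ht hU (tri_sub k1 k2 k3 (by simp) (by intro t; simp; tauto) (by intro t; simp; tauto))
    (by
      intro e he heH
      obtain ⟨m, hm, n, hn, rfl⟩ := mem_tri.1 he
      have heH : T H a m n := heH
      simp only [mem_insert, mem_singleton] at hm hn
      rcases hm with rfl | rfl <;> rcases hn with rfl | rfl | rfl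
      · exact hp.mid h1 e3 heH.s23 (by grind) (by grind) (by grind)
      · exact hp.mid h1 e3.s12 heH.s23 (by grind) (by grind) (by grind)
      · exact hp.mid h1 e3.rot2 heH.s23 (by grind) (by grind) (by grind)
      · exact hp.mid h1 e3 heH.s23 (by grind) (by grind) (by grind)
      · exact hp.mid h1 e3.s12 heH.s23 (by grind) (by grind) (by grind)
      · exact hp.mid h1 e3.rot2 heH.s23 (by grind) (by grind) (by grind))
  omega

set_option maxHeartbeats 2000000 in
lemma Q.f_dx (h : Q H a b c d x y) (ht : Tri V H) (hp : PF H) {w : α} (hw : Out a b c d x y w)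
    (h1 : T H d x w) : (res H (U6 a b c d x y)).card ≤ 14 := by
  have hU := h.card_U
  obtain ⟨e1, e2, e3, n1, n2, n3, n4⟩ := h
  have k1 : y ∉ ({d, x} : Finset α) := by simp; grind
  have k2 : y ∉ ({a, b, c} : Finset α) := by simp; grind
  have k3 : Disjoint ({d, x} : Finset α) {a, b, c} := by
    rw [disjoint_left]; simp; grind
  have c1 := card_tri k1 k2 k3
  rw [card_pair n4.1, card_eq_three.2 ⟨a, b, c, n1.1, n1.2.1, n2.1, rfl⟩] at c1
  have := res_le ht hU (tri_sub k1 k2 k3 (by simp) (by intro t; simp; tauto) (by intro t; simp; tauto))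
    (by
      intro e he heH
      obtain ⟨m, hm, n, hn, rfl⟩ := mem_tri.1 he
      have heH : T H y m n := heH
      simp only [mem_insert, mem_singleton] at hm hn
      rcases hm with rfl | rfl <;> rcases hn with rfl | rfl | rfl
      · exact hp.mid h1 e1 heH.rot (by grind) (by grind) (by grind)
      · exact hp.mid h1 e1.s12 heH.rot (by grind) (by grind) (by grind)
      · exact hp.mid h1 e1.rot2 heH.rot (by grind) (by grind) (by grind)
      · exact hp.mid h1.s12 e1 heH.rot (by grind) (by grind) (by grind)
      · exact hp.mid h1.s12 e1.s12 heH.rot (by grind) (by grind) (by grind)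
      · exact hp.mid h1.s12 e1.rot2 heH.rot (by grind) (by grind) (by grind))
  omega

lemma Q.sxy (h : Q H a b c d x y) : Q H a b c d y x := by
  obtain ⟨e1, e2, e3, n1, n2, n3, n4⟩ := h
  exact ⟨e1, e2, e3.s23, by tauto, by tauto, by tauto, by grind⟩

lemma Q.sbc (h : Q H a b c d x y) : Q H a c b d x y := by
  obtain ⟨e1, e2, e3, n1, n2, n3, n4⟩ := h
  exact ⟨e1.s23, e2.s12, e3, by tauto, by grind, by tauto, by grind⟩

lemma Out.sxy {a b c d x y w : α} (h : Out a b c d x y w) : Out a b c d y x w := by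
  obtain ⟨h1, h2, h3, h4, h5, h6⟩ := h
  exact ⟨h1, h2, h3, h4, h6, h5⟩

lemma Q.f_dy (h : Q H a b c d x y) (ht : Tri V H) (hp : PF H) {w : α} (hw : Out a b c d x y w)
    (h1 : T H d y w) : (res H (U6 a b c d x y)).card ≤ 14 := by
  have := h.sxy.f_dx ht hp hw.sxy h1
  have e : U6 a b c d x y = U6 a b c d y x := by
    rw [U6, U6, Finset.pair_comm]
  rwa [e]

set_option maxHeartbeats 2000000 in
lemma Q.f_xy (h : Q H a b c d x y) (ht : Tri V H) (hp : PF H) {w : α} (hw : Out a b c d x y w)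
    (h1 : T H x y w) : (res H (U6 a b c d x y)).card ≤ 10 := by
  have hU := h.card_U
  obtain ⟨e1, e2, e3, n1, n2, n3, n4⟩ := h
  have k1 : d ∉ ({x, y} : Finset α) := by simp; grind
  have k2 : d ∉ ({a, b, c} : Finset α) := by simp; grind
  have k3 : Disjoint ({x, y} : Finset α) {a, b, c} := by
    rw [disjoint_left]; simp; grind
  have k4 : a ∉ ({x, y} : Finset α) := by simp; grind
  have k5 : a ∉ ({b, c} : Finset α) := by simp; grind
  have k6 : Disjoint ({x, y} : Finset α) {b, c} := by
    rw [disjoint_left]; simp; grind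
  have c1 := card_tri k1 k2 k3
  rw [card_pair n4.2.2, card_eq_three.2 ⟨a, b, c, n1.1, n1.2.1, n2.1, rfl⟩] at c1
  have c2 := card_tri k4 k5 k6
  rw [card_pair n4.2.2, card_pair n2.1] at c2
  have hdis : Disjoint (tri d {x, y} {a, b, c}) (tri a {x, y} {b, c}) := by
    rw [disjoint_left]
    intro e he he'
    obtain ⟨m, hm, n, hn, rfl⟩ := mem_tri.1 he
    obtain ⟨m', hm', n', hn', he''⟩ := mem_tri.1 he'
    have : d ∈ ({a, m', n'} : Finset α) := by rw [← he'']; simp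
    simp only [mem_insert, mem_singleton] at hm hn hm' hn' this
    grind
  have c3 := card_union_of_disjoint hdis
  have := res_le ht hU (union_subset
    (tri_sub k1 k2 k3 (by simp) (by intro t; simp; tauto) (by intro t; simp; tauto))
    (tri_sub k4 k5 k6 (by simp) (by intro t; simp; tauto) (by intro t; simp; tauto)))
    (by
      intro e he heH
      rcases mem_union.1 he with he | he
      · obtain ⟨m, hm, n, hn, rfl⟩ := mem_tri.1 he
        have heH : T H d m n := heH
        simp only [mem_insert, mem_singleton] at hm hn
        rcases hm with rfl | rfl <;> rcases hn with rfl | rfl | rfl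
        · exact hp.mid h1 e1 heH.rot (by grind) (by grind) (by grind)
        · exact hp.mid h1 e1.s12 heH.rot (by grind) (by grind) (by grind)
        · exact hp.mid h1 e1.rot2 heH.rot (by grind) (by grind) (by grind)
        · exact hp.mid h1.s12 e1 heH.rot (by grind) (by grind) (by grind)
        · exact hp.mid h1.s12 e1.s12 heH.rot (by grind) (by grind) (by grind)
        · exact hp.mid h1.s12 e1.rot2 heH.rot (by grind) (by grind) (by grind)
      · obtain ⟨m, hm, n, hn, rfl⟩ := mem_tri.1 he
        have heH : T H a m n := heH
        simp only [mem_insert, mem_singleton] at hm hn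
        rcases hm with rfl | rfl <;> rcases hn with rfl | rfl
        · exact hp.mid h1 e2 heH.rot (by grind) (by grind) (by grind)
        · exact hp.mid h1 e2.s12 heH.rot (by grind) (by grind) (by grind)
        · exact hp.mid h1.s12 e2 heH.rot (by grind) (by grind) (by grind)
        · exact hp.mid h1.s12 e2.s12 heH.rot (by grind) (by grind) (by grind))
  omega

end

end LP

namespace LP
open Finset

variable {α : Type*} [DecidableEq α]

section
variable {V : Finset α} {H : Finset (Finset α)} {a b c d x y : α}

lemma Q.card_W (h : Q H a b c d x y) (ht : Tri V H) :
    (V \ U6 a b c d x y).card + 6 = V.card := by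
  have h1 := card_sdiff_of_subset (h.sub_U ht)
  have h2 := card_le_card (h.sub_U ht)
  rw [h.card_U] at h1 h2
  omega

lemma Q.nocross {n : ℕ} (hn : n ≤ 15) (hn7 : 7 ≤ n) (ih : IH α n) (hV : V.card = n)
    (h : Q H a b c d x y) (ht : Tri V H) (hp : PF H)
    (hc : ∀ e ∈ H, e ⊆ U6 a b c d x y ∨ Disjoint e (U6 a b c d x y)) : Concl V H := by
  have h1 := h.card_W ht
  have hc2 : ∀ e ∈ H, e ⊆ U6 a b c d x y ∨ e ⊆ V \ U6 a b c d x y := by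
    intro e he
    rcases hc e he with h2 | h2
    · exact Or.inl h2
    · exact Or.inr (subset_sdiff.2 ⟨(ht e he).1, h2⟩)
  by_cases h3 : 3 ≤ (V \ U6 a b c d x y).card
  · exact split_concl hn hn7 ih hV (by rw [h.card_U]; omega) h3 disjoint_sdiff
      (union_sdiff_of_subset (h.sub_U ht)) ht hp hc2
  · right; left
    have : Tri (U6 a b c d x y) H := by
      intro e he
      refine ⟨?_, (ht e he).2⟩
      rcases hc2 e he with h2 | h2
      · exact h2
      · have := card_le_card h2
        rw [(ht e he).2] at this
        omega
    have := tri_card this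
    rw [h.card_U] at this
    have h20 : Nat.choose 6 3 = 20 := by decide
    have hB : B V.card = 20 := by rw [B, if_pos (by omega)]
    omega

lemma Q.cross (h : Q H a b c d x y) (ht : Tri V H) (hp : PF H) (hN : NoCfg H)
    (hc : ∃ e ∈ H, ¬ e ⊆ U6 a b c d x y ∧ ¬ Disjoint e (U6 a b c d x y)) :
    (res H (U6 a b c d x y)).card ≤ 14 := by
  obtain ⟨e, he, h1, h2⟩ := hc
  obtain ⟨w, hwe, hw⟩ := not_subset.1 h1
  rw [not_mem_U6] at hw
  rcases h.edge ht hp hN hw he hwe with ⟨p, q, k1, rfl, k3, k4⟩ | ⟨q, k1, k2, k3⟩ | k | k | k | k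
  · exfalso
    apply h2
    rw [disjoint_left]
    intro t htm
    simp only [mem_insert, mem_singleton] at htm
    rcases htm with rfl | rfl | rfl
    · exact not_mem_U6.2 hw
    · exact not_mem_U6.2 k3
    · exact not_mem_U6.2 k4
  · exact h.f_a ht hp hw k3 (k1.ne ht).2.2 k1
  · exact h.f_bc ht hp hw k.1
  · exact (h.f_xy ht hp hw k.1).trans (by norm_num)
  · exact h.f_dx ht hp hw k.1
  · exact h.f_dy ht hp hw k.1

open Classical in
lemma Q.small (h : Q H a b c d x y) (ht : Tri V H) (hp : PF H) (hN : NoCfg H)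
    (hV : V.card ≤ 9) (hV7 : 7 ≤ V.card)
    (hc : ∃ e ∈ H, ¬ e ⊆ U6 a b c d x y ∧ ¬ Disjoint e (U6 a b c d x y)) :
    H.card ≤ B V.card := by
  have hu := h.cross ht hp hN hc
  have hW := h.card_W ht
  set W := V \ U6 a b c d x y with hWd
  have mW : ∀ w ∈ W, Out a b c d x y w := by
    intro w hw
    rw [hWd, mem_sdiff, not_mem_U6] at hw
    exact hw.2
  set C := W.filter (fun w => T H b c w) with hC
  set X := W.filter (fun w => T H x y w) with hX
  set D1 := W.filter (fun w => T H d x w) with hD1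
  set D2 := W.filter (fun w => T H d y w) with hD2
  set S := W.filter (fun w => ∃ w' ∈ W, T H a w w') with hS
  have hcov : H ⊆ res H (U6 a b c d x y) ∪ (res H W ∪ (C.image (fun w => {b, c, w}) ∪
      (X.image (fun w => {x, y, w}) ∪ (D1.image (fun w => {d, x, w}) ∪
      (D2.image (fun w => {d, y, w}) ∪ (powersetCard 2 S).image (insert a)))))) := by
    intro e he
    by_cases h1 : e ⊆ U6 a b c d x y
    · exact mem_union_left _ (mem_filter.2 ⟨he, h1⟩)
    · apply mem_union_right
      obtain ⟨w, hwe, hw⟩ := not_subset.1 h1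
      have hwW : w ∈ W := mem_sdiff.2 ⟨(ht e he).1 hwe, hw⟩
      rw [not_mem_U6] at hw
      simp only [mem_union, mem_image, hC, hX, hD1, hD2, mem_filter]
      rcases h.edge ht hp hN hw he hwe with ⟨p, q, k1, k2, k3, k4⟩ | ⟨q, k1, k2, k3⟩ | k | k | k | k
      · left
        refine mem_filter.2 ⟨he, ?_⟩
        rw [k2]
        have m := k1.mem ht
        intro t htm
        simp only [mem_insert, mem_singleton] at htm
        rcases htm with rfl | rfl | rfl
        · exact hwW
        · exact mem_sdiff.2 ⟨m.2.1, not_mem_U6.2 k3⟩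
        · exact mem_sdiff.2 ⟨m.2.2, not_mem_U6.2 k4⟩
      · right; right; right; right; right
        have hqW : q ∈ W := mem_sdiff.2 ⟨(k1.mem ht).2.2, not_mem_U6.2 k3⟩
        refine ⟨{w, q}, ?_, k2.symm⟩
        rw [mem_powersetCard]
        refine ⟨?_, card_pair (k1.ne ht).2.2⟩
        intro t htm
        simp only [mem_insert, mem_singleton] at htm
        rcases htm with rfl | rfl
        · exact mem_filter.2 ⟨hwW, q, hqW, k1⟩
        · exact mem_filter.2 ⟨hqW, w, hwW, k1.s23⟩
      · right; left; exact ⟨w, ⟨hwW, k.1⟩, k.2.symm⟩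
      · right; right; left; exact ⟨w, ⟨hwW, k.1⟩, k.2.symm⟩
      · right; right; right; left; exact ⟨w, ⟨hwW, k.1⟩, k.2.symm⟩
      · right; right; right; right; left; exact ⟨w, ⟨hwW, k.1⟩, k.2.symm⟩
  have hcard : H.card ≤ (res H (U6 a b c d x y)).card + ((res H W).card + (C.card +
      (X.card + (D1.card + (D2.card + S.card.choose 2))))) := by
    refine (card_le_card hcov).trans ?_
    refine (card_union_le _ _).trans (Nat.add_le_add le_rfl ?_)
    refine (card_union_le _ _).trans (Nat.add_le_add le_rfl ?_)
    refine (card_union_le _ _).trans (Nat.add_le_add card_image_le ?_)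
    refine (card_union_le _ _).trans (Nat.add_le_add card_image_le ?_)
    refine (card_union_le _ _).trans (Nat.add_le_add card_image_le ?_)
    refine (card_union_le _ _).trans (Nat.add_le_add card_image_le ?_)
    refine card_image_le.trans ?_
    rw [card_powersetCard]
  have cC : C.card ≤ W.card := card_le_card (filter_subset _ _)
  have cS : S.card ≤ W.card := card_le_card (filter_subset _ _)
  have dis : ∀ Y : Finset α, Y ⊆ W → (∀ w ∈ Y, w ∉ S) → Y.card + S.card ≤ W.card := by
    intro Y hY hYS
    rw [← card_union_of_disjoint (disjoint_left.2 hYS)]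
    exact card_le_card (union_subset hY (filter_subset _ _))
  have cX : X.card + S.card ≤ W.card := by
    refine dis X (filter_subset _ _) fun w hw hwS => ?_
    rw [hS, mem_filter] at hwS
    rw [hX, mem_filter] at hw
    obtain ⟨h1, w', h2, h3⟩ := hwS
    exact (h.a_xy hp (mW w h1) (mW w' h2) (h3.ne ht).2.2 h3).1 hw.2
  have cD1 : D1.card + S.card ≤ W.card := by
    refine dis D1 (filter_subset _ _) fun w hw hwS => ?_
    rw [hS, mem_filter] at hwS
    rw [hD1, mem_filter] at hw
    obtain ⟨h1, w', h2, h3⟩ := hwS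
    exact (h.a_xy hp (mW w h1) (mW w' h2) (h3.ne ht).2.2 h3).2.1 hw.2
  have cD2 : D2.card + S.card ≤ W.card := by
    refine dis D2 (filter_subset _ _) fun w hw hwS => ?_
    rw [hS, mem_filter] at hwS
    rw [hD2, mem_filter] at hw
    obtain ⟨h1, w', h2, h3⟩ := hwS
    exact (h.a_xy hp (mW w h1) (mW w' h2) (h3.ne ht).2.2 h3).2.2 hw.2
  have cS2 : S.card ≠ 1 := by
    intro h1
    obtain ⟨w, hw⟩ := card_eq_one.1 h1
    have hw1 : w ∈ S := by rw [hw]; simp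
    obtain ⟨h2, w', h3, h4⟩ := mem_filter.1 hw1
    have : w' ∈ S := mem_filter.2 ⟨h3, w, h2, h4.s23⟩
    rw [hw, mem_singleton] at this
    exact (h4.ne ht).2.2 this.symm
  have cXu : X.card = 0 ∨ (res H (U6 a b c d x y)).card ≤ 10 := by
    rcases X.eq_empty_or_nonempty with h1 | ⟨w, hw⟩
    · left; rw [h1]; rfl
    · right
      rw [hX, mem_filter] at hw
      exact h.f_xy ht hp (mW w hw.1) hw.2
  have cW := tri_card (ht.res W)
  have cWD : (res H W).card = 0 ∨ (D1.card = 0 ∧ D2.card = 0) := by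
    rcases (res H W).eq_empty_or_nonempty with h1 | ⟨e, he⟩
    · left; rw [h1]; rfl
    · right
      have h1 := ht.res W e he
      have h2 : e = W := eq_of_subset_of_card_le h1.1 (by omega)
      have key : ∀ w ∈ W, ¬ T H d x w ∧ ¬ T H d y w := by
        intro w hw
        rw [← h2] at hw
        obtain ⟨p, q, k1, k2⟩ := exT_mem (ht.res W) he hw
        rw [h2] at k2 hw
        have k1 : T H w p q := res_sub _ _ k1
        exact h.www_d hp (mW w hw) (mW p (by rw [k2]; simp)) (mW q (by rw [k2]; simp)) (k1.ne ht) k1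
      refine ⟨?_, ?_⟩
      · rw [card_eq_zero, hD1, filter_eq_empty_iff]
        exact fun w hw => (key w hw).1
      · rw [card_eq_zero, hD2, filter_eq_empty_iff]
        exact fun w hw => (key w hw).2
  have hk : W.card ≤ 3 := by omega
  have hk1 : 1 ≤ W.card := by omega
  rw [← hW]
  generalize W.card = k at *
  generalize S.card = s at *
  have b1 : B (1 + 6) = 20 := by decide
  have b2 : B (2 + 6) = 20 := by decide
  have b3 : B (3 + 6) = 23 := by decide
  have c13 : Nat.choose 1 3 = 0 := by decide
  have c23 : Nat.choose 2 3 = 0 := by decide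
  have c33 : Nat.choose 3 3 = 1 := by decide
  have d0 : Nat.choose 0 2 = 0 := by decide
  have d2 : Nat.choose 2 2 = 1 := by decide
  have d3 : Nat.choose 3 2 = 3 := by decide
  have hs : s = 0 ∨ s = 2 ∨ s = 3 := by omega
  rcases hs with rfl | rfl | rfl <;>
  rcases (show k = 1 ∨ k = 2 ∨ k = 3 by omega) with rfl | rfl | rfl <;> omega

end

end LP

namespace LP
open Finset

variable {α : Type*} [DecidableEq α]

section
variable {V : Finset α} {H : Finset (Finset α)} {a b c d x y : α}

lemma Q.twoK {S R : Finset α} (h : Q H a b c d x y) {H' : Finset (Finset α)} (ht : Tri V H)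
    (hS : S.card = 6) (hR : R.card = 6) (hd : Disjoint S R) (hs : H' ⊆ H)
    (m1 : T H' a b c) (m2 : T H' b c d) (m3 : T H' d x y)
    (hc : ∀ e ∈ H', e ⊆ S ∨ e ⊆ R) (hu : (LP.res H (U6 a b c d x y)).card ≤ 14) : H'.card ≤ 34 := by
  wlog hw : ({b, c, d} : Finset α) ⊆ S generalizing S R
  · rcases hc _ m2 with k | k
    · exact absurd k hw
    · exact this hR hS hd.symm (fun e he => (hc e he).symm) k
  have hb : b ∈ S := hw (by simp)
  have hdd : d ∈ S := hw (by simp)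
  have k1 : ({a, b, c} : Finset α) ⊆ S := by
    rcases hc _ m1 with k | k
    · exact k
    · exact absurd (k (show b ∈ _ by simp)) (disjoint_left.1 hd hb)
  have k3 : ({d, x, y} : Finset α) ⊆ S := by
    rcases hc _ m3 with k | k
    · exact k
    · exact absurd (k (show d ∈ _ by simp)) (disjoint_left.1 hd hdd)
  have hU : U6 a b c d x y = S := by
    apply eq_of_subset_of_card_le
    · intro t htm
      simp only [U6, mem_insert, mem_singleton] at htm
      rcases htm with rfl | rfl | rfl | rfl | rfl | rfl
      · exact k1 (by simp)
      · exact k1 (by simp)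
      · exact k1 (by simp)
      · exact k3 (by simp)
      · exact k3 (by simp)
      · exact k3 (by simp)
    · rw [h.card_U, hS]
  have hsub : H' ⊆ LP.res H (U6 a b c d x y) ∪ LP.res H R := by
    intro e he
    rcases hc e he with k | k
    · exact mem_union_left _ (mem_filter.2 ⟨hs he, by rwa [hU]⟩)
    · exact mem_union_right _ (mem_filter.2 ⟨hs he, k⟩)
  have h1 := (card_le_card hsub).trans (card_union_le _ _)
  have h2 := tri_card (ht.res R)
  rw [hR] at h2
  have h20 : Nat.choose 6 3 = 20 := by decide
  omega

lemma Q.nearU (h : Q H a b c d x y) (ht : Tri V H) (hp : PF H) (hN : NoCfg H)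
    {H' : Finset (Finset α)} (hs : H' ⊆ H)
    (m1 : T H' a b c) (m2 : T H' b c d) (m3 : T H' d x y)
    (hu : (LP.res H (U6 a b c d x y)).card ≤ 14) (hn : Near H') : H'.card + 12 ≤ 15 + 2 * V.card := by
  obtain ⟨u, hu1⟩ := hn
  have n1 := h.n1
  have n2 := h.n2
  have n3 := h.n3
  have n4 := h.n4
  have hne : ∀ e ∈ H', ∀ f ∈ H', e ≠ f → u ∈ e ∨ u ∈ f := by
    intro e he f hf hef
    by_contra hh
    push Not at hh
    exact hef (card_le_one.1 hu1 e (mem_filter.2 ⟨he, hh.1⟩) f (mem_filter.2 ⟨hf, hh.2⟩))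
  have e12 : ({a, b, c} : Finset α) ≠ {b, c, d} := by
    intro hh
    have : a ∈ ({b, c, d} : Finset α) := by rw [← hh]; simp
    simp at this; grind
  have e13 : ({a, b, c} : Finset α) ≠ {d, x, y} := by
    intro hh
    have : a ∈ ({d, x, y} : Finset α) := by rw [← hh]; simp
    simp at this; grind
  have e23 : ({b, c, d} : Finset α) ≠ {d, x, y} := by
    intro hh
    have : b ∈ ({d, x, y} : Finset α) := by rw [← hh]; simp
    simp at this; grind
  have q1 := hne _ m1 _ m2 e12
  have q2 := hne _ m1 _ m3 e13
  have q3 := hne _ m2 _ m3 e23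
  simp only [mem_insert, mem_singleton] at q1 q2 q3
  have hub : u = b ∨ u = c ∨ u = d := by grind
  clear q1 q2 q3
  have hW := h.card_W ht
  set W := V \ U6 a b c d x y with hWd
  have hsub : H' ⊆ H'.filter (fun e => u ∉ e) ∪ (LP.res H (U6 a b c d x y) ∪
      (W.image (fun w => if u = d then {d, x, w} else {b, c, w}) ∪
       W.image (fun w => {d, y, w}))) := by
    intro e he
    by_cases hue : u ∈ e
    swap
    · exact mem_union_left _ (mem_filter.2 ⟨he, hue⟩)
    apply mem_union_right
    by_cases h1 : e ⊆ U6 a b c d x y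
    · exact mem_union_left _ (mem_filter.2 ⟨hs he, h1⟩)
    apply mem_union_right
    obtain ⟨w, hwe, hw⟩ := not_subset.1 h1
    have hwW : w ∈ W := mem_sdiff.2 ⟨(ht e (hs he)).1 hwe, hw⟩
    rw [not_mem_U6] at hw
    simp only [mem_union, mem_image]
    rcases h.edge ht hp hN hw (hs he) hwe with ⟨p, q, k1, rfl, k3, k4⟩ | ⟨q, k1, rfl, k3⟩ |
      ⟨k, rfl⟩ | ⟨k, rfl⟩ | ⟨k, rfl⟩ | ⟨k, rfl⟩
    · simp only [mem_insert, mem_singleton] at hue; grind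
    · simp only [mem_insert, mem_singleton] at hue; grind
    · left
      refine ⟨w, hwW, ?_⟩
      rw [if_neg]
      simp only [mem_insert, mem_singleton] at hue; grind
    · simp only [mem_insert, mem_singleton] at hue; grind
    · left
      refine ⟨w, hwW, ?_⟩
      rw [if_pos]
      simp only [mem_insert, mem_singleton] at hue; grind
    · right
      exact ⟨w, hwW, rfl⟩
  have h1 := card_le_card hsub
  have h2 : (W.image (fun w => if u = d then ({d, x, w} : Finset α) else {b, c, w})).card ≤ W.card :=
    card_image_le
  have h3 : (W.image (fun w => ({d, y, w} : Finset α))).card ≤ W.card := card_image_le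
  have h4 := card_union_le (W.image (fun w => if u = d then ({d, x, w} : Finset α) else {b, c, w}))
    (W.image (fun w => ({d, y, w} : Finset α)))
  have h5 := card_union_le (LP.res H (U6 a b c d x y)) (W.image (fun w => if u = d then ({d, x, w} : Finset α) else {b, c, w}) ∪
    W.image (fun w => ({d, y, w} : Finset α)))
  have h6 := h1.trans (card_union_le _ _)
  omega

lemma B_step : ∀ n : ℕ, 10 ≤ n → n ≤ 15 → B (n - 1) + 4 ≤ B n ∧ 7 + 2 * n ≤ B n := by
  have : ∀ n ∈ Finset.range 16, 10 ≤ n → n ≤ 15 → B (n - 1) + 4 ≤ B n ∧ 7 + 2 * n ≤ B n := by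
    decide +kernel
  exact fun n h1 h2 => this n (by simp; omega) h1 h2

lemma Q.deg5 {n : ℕ} (hn : n ≤ 15) (hn7 : 10 ≤ n) (ih : IH α n) (hV : V.card = n)
    (hnc : ¬ Concl V H)
    (h : Q H a b c d x y) (ht : Tri V H) (hp : PF H) (hN : NoCfg H) {w : α}
    (hw : Out a b c d x y w) (hwV : w ∈ V) : 5 ≤ (H.filter (fun e => w ∈ e)).card := by
  by_contra hlt
  have hc : ∃ e ∈ H, ¬ e ⊆ U6 a b c d x y ∧ ¬ Disjoint e (U6 a b c d x y) := by
    by_contra hh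
    push Not at hh
    exact hnc (h.nocross hn (by omega) ih hV ht hp (fun e he => by
      by_cases k : e ⊆ U6 a b c d x y
      · exact Or.inl k
      · exact Or.inr (hh e he k)))
  have hu := h.cross ht hp hN hc
  have hsp := card_filter_add_card_filter_not (s := H) (fun e => w ∈ e)
  set H' := H.filter (fun e => w ∉ e) with hH'
  have hs : H' ⊆ H := filter_subset _ _
  have m1 : T H' a b c := mem_filter.2 ⟨h.abc, by simp; grind⟩
  have m2 : T H' b c d := mem_filter.2 ⟨h.bcd, by simp; grind⟩
  have m3 : T H' d x y := mem_filter.2 ⟨h.dxy, by simp; grind⟩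
  have ht' : Tri (V.erase w) H' := by
    intro e he
    rw [hH', mem_filter] at he
    exact ⟨subset_erase.2 ⟨(ht e he.1).1, he.2⟩, (ht e he.1).2⟩
  have hcV : (V.erase w).card = n - 1 := by rw [card_erase_of_mem hwV, hV]
  have hBs := B_step n hn7 hn
  apply hnc
  right; left
  rw [hV]
  rcases ih (V.erase w) H' (by omega) (by omega) ht' (hp.mono hs) with k | k | ⟨k1, S, R, k2, k3, k4, k5, k6⟩
  · have := h.nearU ht hp hN hs m1 m2 m3 hu k
    omega
  · rw [hcV] at k
    omega
  · have := h.twoK ht k2 k3 k4 hs m1 m2 m3 k6 hu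
    have h13 : n = 13 := by omega
    subst h13
    have : B 13 = 40 := by decide
    omega

end
end LP

namespace LP
open Finset

variable {α : Type*} [DecidableEq α]

section
variable {V : Finset α} {H : Finset (Finset α)} {a b c d x y : α}

def D5 (V : Finset α) (H : Finset (Finset α)) : Prop :=
  ∀ a b c d x y : α, Q H a b c d x y → ∀ w ∈ V, Out a b c d x y w →
    5 ≤ (H.filter (fun e => w ∈ e)).card

lemma D5.no4 (hD : D5 V H) (h : Q H a b c d x y) {w : α} (hw : w ∈ V) (ho : Out a b c d x y w)
    (e1 e2 e3 e4 : Finset α) (hc : ∀ e ∈ H, w ∈ e → e = e1 ∨ e = e2 ∨ e = e3 ∨ e = e4) : False := by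
  have h1 := hD _ _ _ _ _ _ h w hw ho
  have : H.filter (fun e => w ∈ e) ⊆ {e1, e2, e3, e4} := by
    intro e he
    rw [mem_filter] at he
    simpa using hc e he.1 he.2
  have := card_le_card this
  have := card_le_four (a := e1) (b := e2) (c := e3) (d := e4)
  omega

lemma Q.lA (h : Q H a b c d x y) (hp : PF H) {w s p q : α} (hw : Out a b c d x y w)
    (hs : Out a b c d x y s) (ho : Out a b c d x y p) (hq : Out a b c d x y q)
    (hne : w ≠ s) (hne2 : w ≠ p ∧ w ≠ q ∧ p ≠ q) (h1 : T H a w s) (h2 : T H w p q) :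
    s = p ∨ s = q := by
  by_contra hh
  push Not at hh
  obtain ⟨n1, n2, n3, n4⟩ := h.n1, h.n2, h.n3, h.n4
  exact hp.p7 h.abc.rot h1.s23 h2 (by grind)

lemma Q.lB (h : Q H a b c d x y) (hN : NoCfg H) {s t u v : α} (hs : Out a b c d x y s)
    (ht : Out a b c d x y t) (hu : Out a b c d x y u) (hv : Out a b c d x y v)
    (hne : s ≠ t) (hne2 : u ≠ v) (h1 : T H a s t) (h2 : T H a u v) :
    s = u ∨ s = v ∨ t = u ∨ t = v := by
  by_contra hh
  push Not at hh
  obtain ⟨n1, n2, n3, n4⟩ := h.n1, h.n2, h.n3, h.n4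
  exact hN d b c a s t u v ⟨h.bcd.rot2, h.abc.rot, h1, h2, by grind, by grind, by grind, by grind⟩

lemma Q.s1a (h : Q H a b c d x y) (ht : Tri V H) (hp : PF H) (hN : NoCfg H) (hD : D5 V H)
    {w w' s : α} (hw : Out a b c d x y w) (hw' : Out a b c d x y w') (hs : Out a b c d x y s)
    (h1 : T H a w w') (h2 : T H a w s) : s = w' := by
  by_contra hss
  have m1 := h1.mem ht
  have m2 := h2.mem ht
  have k1 := h1.ne ht
  have k2 := h2.ne ht
  by_cases hex : ∃ s2, Out a b c d x y s2 ∧ s2 ≠ w' ∧ s2 ≠ s ∧ T H a w s2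
  · obtain ⟨s2, o2, g1, g2, h3⟩ := hex
    have k3 := h3.ne ht
    refine hD.no4 h m1.2.2 hw' {b, c, w'} {a, w', w} ∅ ∅ fun e he hwe => ?_
    have ex := h.a_xy hp hw' hw k1.2.2.symm h1.s23
    rcases h.edge ht hp hN hw' he hwe with ⟨p, q, f1, f2, f3, f4⟩ | ⟨q, f1, f2, f3⟩ | f | f | f | f
    · exfalso
      have kk := f1.ne ht
      rcases h.lA hp hw' hw f3 f4 k1.2.2.symm kk h1.s23 f1 with rfl | rfl
      · have r1 := h.lA hp hw hs hw' f4 k2.2.2 ⟨kk.1.symm, kk.2.2, kk.2.1⟩ h2 f1.s12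
        have r2 := h.lA hp hw o2 hw' f4 k3.2.2 ⟨kk.1.symm, kk.2.2, kk.2.1⟩ h3 f1.s12
        grind
      · have r1 := h.lA hp hw hs hw' f3 k2.2.2 ⟨kk.2.1.symm, kk.2.2.symm, kk.1⟩ h2 f1.rot2
        have r2 := h.lA hp hw o2 hw' f3 k3.2.2 ⟨kk.2.1.symm, kk.2.2.symm, kk.1⟩ h3 f1.rot2
        grind
    · right; left
      have kk := f1.ne ht
      have r1 := h.lB hN hw' f3 hw hs kk.2.2 k2.2.2 f1 h2
      have r2 := h.lB hN hw' f3 hw o2 kk.2.2 k3.2.2 f1 h3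
      have : q = w := by grind
      rw [f2, this]
    · left; exact f.2
    · exact absurd f.1 ex.1
    · exact absurd f.1 ex.2.1
    · exact absurd f.1 ex.2.2
  · push Not at hex
    refine hD.no4 h m1.2.1 hw {b, c, w} {a, w, w'} {a, w, s} {w, w', s} fun e he hwe => ?_
    have ex := h.a_xy hp hw hw' k1.2.2 h1
    rcases h.edge ht hp hN hw he hwe with ⟨p, q, f1, f2, f3, f4⟩ | ⟨q, f1, f2, f3⟩ | f | f | f | f
    · right; right; right
      have kk := f1.ne ht
      have r1 := h.lA hp hw hw' f3 f4 k1.2.2 kk h1 f1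
      have r2 := h.lA hp hw hs f3 f4 k2.2.2 kk h2 f1
      have : (p = w' ∧ q = s) ∨ (p = s ∧ q = w') := by grind
      rcases this with ⟨rfl, rfl⟩ | ⟨rfl, rfl⟩
      · exact f2
      · rw [f2]; congr 1; exact pair_comm _ _
    · have : q = w' ∨ q = s := by
        by_contra hh
        push Not at hh
        exact hex q f3 hh.1 hh.2 f1
      rcases this with rfl | rfl
      · right; left; exact f2
      · right; right; left; exact f2
    · left; exact f.2
    · exact absurd f.1 ex.1
    · exact absurd f.1 ex.2.1
    · exact absurd f.1 ex.2.2

lemma Q.uniq (h : Q H a b c d x y) (ht : Tri V H) (hp : PF H) (hN : NoCfg H) (hD : D5 V H)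
    {s t u v : α} (hs : Out a b c d x y s) (hT : Out a b c d x y t) (hu : Out a b c d x y u)
    (hv : Out a b c d x y v) (h1 : T H a s t) (h2 : T H a u v) :
    (s = u ∧ t = v) ∨ (s = v ∧ t = u) := by
  rcases h.lB hN hs hT hu hv (h1.ne ht).2.2 (h2.ne ht).2.2 h1 h2 with rfl | rfl | rfl | rfl
  · exact Or.inl ⟨rfl, h.s1a ht hp hN hD hs hv hT h2 h1⟩
  · exact Or.inr ⟨rfl, h.s1a ht hp hN hD hs hu hT h2.s23 h1⟩
  · exact Or.inr ⟨h.s1a ht hp hN hD hT hv hs h2 h1.s23, rfl⟩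
  · exact Or.inl ⟨h.s1a ht hp hN hD hT hu hs h2.s23 h1.s23, rfl⟩

lemma Q.step1 (h : Q H a b c d x y) (ht : Tri V H) (hp : PF H) (hN : NoCfg H) (hD : D5 V H)
    {w w' : α} (hw : Out a b c d x y w) (hw' : Out a b c d x y w') (h1 : T H a w w') : False := by
  have k1 := h1.ne ht
  have m1 := h1.mem ht
  obtain ⟨z, oz, hz⟩ : ∃ z, Out a b c d x y z ∧ T H z w w' := by
    by_contra hno
    push Not at hno
    refine hD.no4 h m1.2.1 hw {b, c, w} {a, w, w'} ∅ ∅ fun e he hwe => ?_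
    have ex := h.a_xy hp hw hw' k1.2.2 h1
    rcases h.edge ht hp hN hw he hwe with ⟨p, q, f1, f2, f3, f4⟩ | ⟨q, f1, f2, f3⟩ | f | f | f | f
    · exfalso
      rcases h.lA hp hw hw' f3 f4 k1.2.2 (f1.ne ht) h1 f1 with rfl | rfl
      · exact hno q f4 f1.rot2
      · exact hno p f3 f1.s12
    · right; left
      rw [f2, h.s1a ht hp hN hD hw hw' f3 h1 f1]
    · left; exact f.2
    · exact absurd f.1 ex.1
    · exact absurd f.1 ex.2.1
    · exact absurd f.1 ex.2.2
  have kz := hz.ne ht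
  obtain ⟨n1, n2, n3, n4⟩ := h.n1, h.n2, h.n3, h.n4
  have h3 : Q H z w w' a b c := ⟨hz, h1.rot, h.abc, by grind, by grind, by grind, by grind⟩
  have key : ∀ e ∈ H, z ∈ e → e = {b, c, z} ∨ e = {z, w, w'} ∨
      ∃ p q, e = {z, p, q} ∧ T H z p q ∧ Out z w w' a b c p ∧ Out z w w' a b c q := by
    intro e he hze
    have ex := h.www_d hp oz hw hw' kz hz
    rcases h.edge ht hp hN oz he hze with ⟨p, q, f1, f2, f3, f4⟩ | ⟨q, f1, f2, f3⟩ | f | f | f | f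
    · have kf := f1.ne ht
      by_cases c1 : p = w ∨ p = w' ∨ q = w ∨ q = w'
      · right; left
        rcases c1 with rfl | rfl | rfl | rfl
        · have := h.lA hp hw hw' oz f4 k1.2.2 (by grind) h1 f1.s12
          have : q = w' := by grind
          rw [f2, this]
        · have := h.lA hp hw' hw oz f4 k1.2.2.symm (by grind) h1.s23 f1.s12
          have : q = w := by grind
          rw [f2, this, pair_comm]
        · have := h.lA hp hw hw' oz f3 k1.2.2 (by grind) h1 f1.rot2
          have : p = w' := by grind
          rw [f2, this, pair_comm]
        · have := h.lA hp hw' hw oz f3 k1.2.2.symm (by grind) h1.s23 f1.rot2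
          have : p = w := by grind
          rw [f2, this]
      · right; right
        exact ⟨p, q, f2, f1, by grind, by grind⟩
    · exfalso
      have := h.uniq ht hp hN hD hw hw' oz f3 h1 f1
      grind
    · left; exact f.2
    · right; right
      exact ⟨x, y, by rw [f.2]; ext; simp; tauto, f.1.rot2, by grind, by grind⟩
    · exact absurd f.1 ex.1
    · exact absurd f.1 ex.2
  by_cases hex : ∃ p q, T H z p q ∧ Out z w w' a b c p ∧ Out z w w' a b c q
  · obtain ⟨p, q, g1, g2, g3⟩ := hex
    refine hD.no4 h (hz.mem ht).1 oz {b, c, z} {z, w, w'} {z, p, q} ∅ fun e he hwe => ?_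
    rcases key e he hwe with k | k | ⟨p', q', k2, k3, k4, k5⟩
    · exact Or.inl k
    · exact Or.inr (Or.inl k)
    · right; right; left
      rcases h3.uniq ht hp hN hD g2 g3 k4 k5 g1 k3 with ⟨rfl, rfl⟩ | ⟨rfl, rfl⟩
      · exact k2
      · rw [k2, pair_comm]
  · push Not at hex
    refine hD.no4 h (hz.mem ht).1 oz {b, c, z} {z, w, w'} ∅ ∅ fun e he hwe => ?_
    rcases key e he hwe with k | k | ⟨p', q', k2, k3, k4, k5⟩
    · exact Or.inl k
    · exact Or.inr (Or.inl k)
    · exact (hex p' q' k3 k4 k5).elim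

lemma Q.big {n : ℕ} (hn : n ≤ 15) (hn7 : 10 ≤ n) (ih : IH α n) (hV : V.card = n)
    (h : Q H a b c d x y) (ht : Tri V H) (hp : PF H) (hN : NoCfg H) : Concl V H := by
  by_contra hnc
  have hD : D5 V H := fun a b c d x y h w hw ho => h.deg5 hn hn7 ih hV hnc ht hp hN ho hw
  apply hnc
  obtain ⟨n1, n2, n3, n4⟩ := h.n1, h.n2, h.n3, h.n4
  have key : ∀ w ∈ V, Out a b c d x y w → ∀ e ∈ H, w ∈ e → Disjoint e (U6 a b c d x y) := by
    intro w hwV hw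
    obtain ⟨w1, w2, g, o1, o2⟩ : ∃ w1 w2, T H w w1 w2 ∧ Out a b c d x y w1 ∧ Out a b c d x y w2 := by
      by_contra hno
      push Not at hno
      refine hD.no4 h hwV hw {b, c, w} {x, y, w} {d, x, w} {d, y, w} fun e he hwe => ?_
      rcases h.edge ht hp hN hw he hwe with ⟨p, q, f1, f2, f3, f4⟩ | ⟨q, f1, f2, f3⟩ | f | f | f | f
      · exact (hno p q f1 f3 f4).elim
      · exact (h.step1 ht hp hN hD hw f3 f1).elim
      · exact Or.inl f.2
      · exact Or.inr (Or.inl f.2)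
      · exact Or.inr (Or.inr (Or.inl f.2))
      · exact Or.inr (Or.inr (Or.inr f.2))
    have kg := g.ne ht
    have ex := h.www_d hp hw o1 o2 kg g
    intro e he hwe
    rcases h.edge ht hp hN hw he hwe with ⟨p, q, f1, f2, f3, f4⟩ | ⟨q, f1, f2, f3⟩ | f | f | f | f
    · rw [f2, disjoint_left]
      intro t htm
      simp only [mem_insert, mem_singleton] at htm
      rcases htm with rfl | rfl | rfl
      · exact not_mem_U6.2 hw
      · exact not_mem_U6.2 f3
      · exact not_mem_U6.2 f4
    · exact (h.step1 ht hp hN hD hw f3 f1).elim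
    · exfalso
      have h3 : Q H w b c d x y := ⟨f.1.rot2, h.bcd, h.dxy, by grind, by grind, by grind, by grind⟩
      exact h3.step1 ht hp hN hD (w := w1) (w' := w2) (by grind) (by grind) g
    · exfalso
      have h3 : Q H d x y w w1 w2 := ⟨h.dxy, f.1, g, by grind, by grind, by grind, by grind⟩
      exact h3.step1 ht hp hN hD (w := b) (w' := c) (by grind) (by grind) h.bcd.rot2
    · exact absurd f.1 ex.1
    · exact absurd f.1 ex.2
  refine h.nocross hn (by omega) ih hV ht hp fun e he => ?_
  by_cases h1 : e ⊆ U6 a b c d x y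
  · exact Or.inl h1
  · right
    obtain ⟨w, hwe, hw⟩ := not_subset.1 h1
    exact key w ((ht e he).1 hwe) (not_mem_U6.1 hw) e he hwe

end
end LP

namespace LP
open Finset

variable {α : Type*} [DecidableEq α]

lemma exQ {V : Finset α} {H : Finset (Finset α)} (ht : Tri V H) {e f g : Finset α} (he : e ∈ H)
    (hf : f ∈ H) (hg : g ∈ H) (hef : Disjoint e f) (h2 : (g ∩ e).card = 2) (h1 : ¬ Disjoint g f) :
    ∃ a b c d x y, Q H a b c d x y := by
  obtain ⟨b, c, hbc, hge⟩ := card_eq_two.1 h2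
  obtain ⟨d, hdg, hdf⟩ := not_disjoint_iff.1 h1
  have hb : b ∈ g ∩ e := by rw [hge]; simp
  have hc : c ∈ g ∩ e := by rw [hge]; simp
  rw [mem_inter] at hb hc
  obtain ⟨a, h3, rfl⟩ := exT_mem2 ht he hb.2 hc.2 hbc
  obtain ⟨d', h4, rfl⟩ := exT_mem2 ht hg hb.1 hc.1 hbc
  obtain ⟨x, y, h5, rfl⟩ := exT_mem ht hf hdf
  have k3 := h3.ne ht
  have k4 := h4.ne ht
  have k5 := h5.ne ht
  have hd : ∀ t, t ∈ ({b, c, a} : Finset α) → t ∉ ({d, x, y} : Finset α) := fun t h => disjoint_left.1 hef h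
  simp only [mem_insert, mem_singleton] at hd hdg
  have hdd : d' = d := by grind
  subst hdd
  have hb := hd b (by simp)
  have hc := hd c (by simp)
  have ha := hd a (by simp)
  clear hd
  push Not at hb hc ha
  exact ⟨a, b, c, d', x, y, h3.rot2, h4, h5, by grind, by grind, by grind, by grind⟩

theorem main_step {n : ℕ} (hn : n ≤ 15) (hn7 : 7 ≤ n) (ih : IH α n) {V : Finset α}
    {H : Finset (Finset α)} (hV : V.card = n) (ht : Tri V H) (hp : PF H) : Concl V H := by
  by_cases hi : ∀ e ∈ H, ∀ f ∈ H, ¬ Disjoint e f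
  · exact inter_concl ht (by omega) (by omega) hi
  by_cases hno : ∀ e ∈ H, ∀ f ∈ H, ∀ g ∈ H, Disjoint e f → Disjoint g e ∨ Disjoint g f
  · push Not at hi
    obtain ⟨e, he, f, hf, hef⟩ := hi
    exact caseC hn hn7 ih hV ht hp he hf hef hno
  push Not at hno
  obtain ⟨e, he, f, hf, g, hg, hef, hge, hgf⟩ := hno
  have hQ : ∃ a b c d x y, Q H a b c d x y := by
    have h1 : (g ∩ e).card + (g ∩ f).card ≤ 3 := by
      rw [← card_union_of_disjoint (disjoint_of_subset_left inter_subset_right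
        (disjoint_of_subset_right inter_subset_right hef)), ← (ht g hg).2]
      exact card_le_card (union_subset inter_subset_left inter_subset_left)
    have h2 : 0 < (g ∩ e).card := card_pos.2 (not_disjoint_iff_nonempty_inter.1 hge)
    have h3 : 0 < (g ∩ f).card := card_pos.2 (not_disjoint_iff_nonempty_inter.1 hgf)
    have h4 : ¬ ((g ∩ e).card = 1 ∧ (g ∩ f).card = 1) := fun h =>
      hp e he g hg f hf (by rw [inter_comm]; exact h.1) h.2 hef
    rcases (show (g ∩ e).card = 2 ∨ (g ∩ f).card = 2 by omega) with h5 | h5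
    · exact exQ ht he hf hg hef h5 hgf
    · exact exQ ht hf he hg hef.symm h5 hge
  obtain ⟨a, b, c, d, x, y, h⟩ := hQ
  by_cases hN : NoCfg H
  swap
  · unfold NoCfg at hN
    push Not at hN
    obtain ⟨a, b, c, d, x, y, z, w, hc⟩ := hN
    exact caseBi hn ih hV ht hp hc
  by_cases h9 : n ≤ 9
  · by_cases hc : ∃ e ∈ H, ¬ e ⊆ U6 a b c d x y ∧ ¬ Disjoint e (U6 a b c d x y)
    · exact Or.inr (Or.inl (h.small ht hp hN (by omega) (by omega) hc))
    · push Not at hc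
      refine h.nocross hn hn7 ih hV ht hp fun e he => ?_
      by_cases k : e ⊆ U6 a b c d x y
      · exact Or.inl k
      · exact Or.inr (hc e he k)
  · exact h.big hn (by omega) ih hV ht hp hN

theorem allIH (n : ℕ) : n ≤ 16 → IH α n := by
  induction n with
  | zero => intro _ V H h; omega
  | succ n ih =>
    intro hn V H hV h7 ht hp
    have ih := ih (by omega)
    by_cases h : V.card < n
    · exact ih V H h h7 ht hp
    · have hVn : V.card = n := by omega
      exact main_step (by omega) (by omega) ih hVn ht hp

theorem main_concl {V : Finset α} {H : Finset (Finset α)} (h7 : 7 ≤ V.card) (h15 : V.card ≤ 15)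
    (ht : Tri V H) (hp : PF H) : Concl V H :=
  allIH 16 le_rfl V H (by omega) h7 ht hp

end LP

namespace LP
open Finset

variable {α ι : Type*} [DecidableEq α] [DecidableEq ι]

/-- the families `H i`, `i ∈ I`, are pairwise disjoint 3-graphs on `V` without loose paths -/
structure Fam (V : Finset α) (I : Finset ι) (H : ι → Finset (Finset α)) : Prop where
  tri : ∀ i ∈ I, Tri V (H i)
  pf : ∀ i ∈ I, PF (H i)
  dis : ∀ i ∈ I, ∀ j ∈ I, i ≠ j → Disjoint (H i) (H j)

def unc (V : Finset α) (I : Finset ι) (H : ι → Finset (Finset α)) : Finset (Finset α) :=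
  powersetCard 3 V \ I.biUnion H

def NC (α ι : Type*) [DecidableEq α] [DecidableEq ι] (r m : ℕ) : Prop :=
  ∀ (V : Finset α) (I : Finset ι) (H : ι → Finset (Finset α)), V.card = r + 6 → I.card = r →
    Fam V I H → m < (unc V I H).card

lemma NC.mono {r m m' : ℕ} (h : NC α ι r m) (hm : m' ≤ m) : NC α ι r m' :=
  fun V I H h1 h2 h3 => hm.trans_lt (h V I H h1 h2 h3)

lemma NC.zero : NC α ι 0 8 := by
  intro V I H hV hI _
  rw [card_eq_zero] at hI
  subst hI
  simp only [unc, biUnion_empty, sdiff_empty, card_powersetCard, hV]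
  decide

lemma near_del {r m q : ℕ} (hr : NC α ι r (m + q)) {V : Finset α} {I : Finset ι}
    {H : ι → Finset (Finset α)} (hV : V.card = r + 7) (hI : I.card = r + 1) (hF : Fam V I H)
    {i : ι} (hi : i ∈ I) {v : α} (hv : ((H i).filter (fun e => v ∉ e)).card ≤ q) :
    m < (unc V I H).card := by
  wlog hvV : v ∈ V generalizing v
  · obtain ⟨v', hv'⟩ : V.Nonempty := card_pos.1 (by omega)
    refine this (v := v') (le_trans (card_le_card ?_) hv) hv'
    intro e he
    rw [mem_filter] at he ⊢
    exact ⟨he.1, fun h => hvV ((hF.tri i hi e he.1).1 h)⟩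
  have h1 := hr (V.erase v) (I.erase i) (fun j => (H j).filter (fun e => v ∉ e))
    (by rw [card_erase_of_mem hvV]; omega) (by rw [card_erase_of_mem hi]; omega)
    ⟨fun j hj e he => ?_, fun j hj => (hF.pf j (mem_of_mem_erase hj)).mono (filter_subset _ _),
      fun j hj k hk hjk => disjoint_of_subset_left (filter_subset _ _)
        (disjoint_of_subset_right (filter_subset _ _)
          (hF.dis j (mem_of_mem_erase hj) k (mem_of_mem_erase hk) hjk))⟩
  · have h2 : unc (V.erase v) (I.erase i) (fun j => (H j).filter (fun e => v ∉ e)) ⊆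
        unc V I H ∪ (H i).filter (fun e => v ∉ e) := by
      intro e he
      simp only [unc, mem_sdiff, mem_powersetCard, mem_biUnion, mem_union, mem_filter,
        not_exists, not_and] at he ⊢
      obtain ⟨⟨h3, h4⟩, h5⟩ := he
      have hve : v ∉ e := fun h => by simpa using h3 h
      by_cases hei : e ∈ H i
      · exact Or.inr ⟨hei, hve⟩
      · left
        refine ⟨⟨h3.trans (erase_subset _ _), h4⟩, fun j hj hje => ?_⟩
        have hji : j ≠ i := by rintro rfl; exact hei hje
        exact h5 j (mem_erase.2 ⟨hji, hj⟩) hje hve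
    have h3 := (card_le_card h2).trans (card_union_le _ _)
    omega
  · rw [mem_filter] at he
    have := hF.tri j (mem_of_mem_erase hj) e he.1
    exact ⟨subset_erase.2 ⟨this.1, he.2⟩, this.2⟩

lemma pigeon {m K : ℕ} {V : Finset α} {I : Finset ι}
    {H : ι → Finset (Finset α)} (h : I.card * K + m < V.card.choose 3)
    (hu : (unc V I H).card ≤ m) : ∃ i ∈ I, K < (H i).card := by
  by_contra hh
  push Not at hh
  have h1 : powersetCard 3 V ⊆ unc V I H ∪ I.biUnion H := by
    intro e he
    by_cases h : e ∈ I.biUnion H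
    · exact mem_union_right _ h
    · exact mem_union_left _ (mem_sdiff.2 ⟨he, h⟩)
  have h2 := (card_le_card h1).trans (card_union_le _ _)
  rw [card_powersetCard] at h2
  have h3 := card_biUnion_le_card_mul I H K hh
  omega

lemma NC.step {r m : ℕ} (hr : NC α ι r (m + 1)) (hr8 : r ≤ 8) (hr5 : r ≠ 5)
    (hnum : (r + 1) * B (r + 7) + m < (r + 7).choose 3) : NC α ι (r + 1) m := by
  intro V I H hV hI hF
  by_contra hu
  push Not at hu
  obtain ⟨i, hi, hc⟩ := pigeon (K := B (r + 7)) (by rw [hI, hV]; exact hnum) hu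
  rcases main_concl (by omega) (by omega) (hF.tri i hi) (hF.pf i hi) with ⟨v, h⟩ | h | h
  · exact absurd (near_del hr hV hI hF hi h) (by omega)
  · rw [hV] at h
    exact absurd hc (not_lt.2 h)
  · omega

lemma NC.seven (hr : NC α ι 6 2) : NC α ι 7 2 := by
  intro V I H hV hI hF
  by_contra hu
  push Not at hu
  obtain ⟨i, hi, hc⟩ := pigeon (K := 40) (by rw [hI, hV]; decide) hu
  rcases main_concl (by omega) (by omega) (hF.tri i hi) (hF.pf i hi) with ⟨v, h⟩ | h | h
  · have h0 : ((H i).filter (fun e => v ∉ e)).card ≤ 0 := by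
      by_contra hh
      have := comet (hF.tri i hi) (hF.pf i hi) v (by omega) (by omega)
      rw [hV] at this
      have c1 : (7 + 6 - 4).choose 2 = 36 := by decide
      have c2 : (7 + 6 - 1).choose 2 = 66 := by decide
      have c3 : (7 + 6 - 5).choose 2 = 28 := by decide
      omega
    exact absurd (near_del (q := 0) hr hV hI hF hi h0) (by omega)
  · rw [hV] at h
    have : B (7 + 6) = 40 := by decide
    omega
  · omega

/-- A 3-subset meeting both `A` and `B`. -/
def Cr (A B : Finset α) (e : Finset α) : Prop := e.card = 3 ∧ ¬ e ⊆ A ∧ ¬ e ⊆ B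

open Classical in
noncomputable def cr (A B S : Finset α) : Finset (Finset α) := (powersetCard 3 S).filter (Cr A B)

lemma mem_cr {A B S e : Finset α} : e ∈ cr A B S ↔ e ⊆ S ∧ Cr A B e := by
  simp only [cr, mem_filter, mem_powersetCard, Cr]
  tauto

lemma card_cr {A B S : Finset α} (hd : Disjoint A B) :
    (cr A B S).card + ((S ∩ A).card.choose 3 + (S ∩ B).card.choose 3) = S.card.choose 3 := by
  have h1 : powersetCard 3 S = cr A B S ∪ (powersetCard 3 (S ∩ A) ∪ powersetCard 3 (S ∩ B)) := by
    ext e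
    simp only [mem_union, mem_cr, mem_powersetCard, Cr, subset_inter_iff]
    tauto
  have h2 : Disjoint (powersetCard 3 (S ∩ A)) (powersetCard 3 (S ∩ B)) := by
    rw [disjoint_left]
    intro e h3 h4
    rw [mem_powersetCard, subset_inter_iff] at h3 h4
    have : e ⊆ A ∩ B := subset_inter h3.1.2 h4.1.2
    rw [disjoint_iff_inter_eq_empty.1 hd, subset_empty] at this
    rw [this] at h3
    simp at h3
  have h3 : Disjoint (cr A B S) (powersetCard 3 (S ∩ A) ∪ powersetCard 3 (S ∩ B)) := by
    rw [disjoint_left]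
    intro e h3 h4
    rw [mem_cr] at h3
    rw [mem_union, mem_powersetCard, mem_powersetCard, subset_inter_iff, subset_inter_iff] at h4
    rcases h4 with h4 | h4
    · exact h3.2.2.1 h4.1.2
    · exact h3.2.2.2 h4.1.2
  rw [← card_powersetCard 3 S, h1, card_union_of_disjoint h3, card_union_of_disjoint h2,
    card_powersetCard, card_powersetCard]

lemma num36 : ∀ k l : ℕ, k + l = 6 → 2 ≤ k.choose 3 + l.choose 3 ∧
    (k.choose 3 + l.choose 3 = 2 → k = 3 ∧ l = 3) := by
  have : ∀ k ∈ range 7, ∀ l ∈ range 7, k + l = 6 → 2 ≤ k.choose 3 + l.choose 3 ∧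
    (k.choose 3 + l.choose 3 = 2 → k = 3 ∧ l = 3) := by decide +kernel
  exact fun k l h => this k (by simp; omega) l (by simp; omega) h

lemma cr18 {A B S : Finset α} (hd : Disjoint A B) (hS : S.card = 6) (hAB : S ⊆ A ∪ B) :
    (cr A B S).card ≤ 18 ∧ ((cr A B S).card = 18 → (S ∩ A).card = 3 ∧ (S ∩ B).card = 3) := by
  have h1 := card_cr (S := S) hd
  have h2 : (S ∩ A).card + (S ∩ B).card = 6 := by
    rw [← card_union_of_disjoint (disjoint_of_subset_left inter_subset_right
      (disjoint_of_subset_right inter_subset_right hd)), ← inter_union_distrib_left,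
      inter_eq_left.2 hAB, hS]
  have h3 := num36 _ _ h2
  rw [hS] at h1
  have : Nat.choose 6 3 = 20 := by decide
  refine ⟨by omega, fun h => h3.2 (by omega)⟩

/-- full 3-3 class -/
structure Full (V A B S : Finset α) (H : Finset (Finset α)) : Prop where
  a3 : (S ∩ A).card = 3
  b3 : (S ∩ B).card = 3
  sub : S ⊆ V
  all : ∀ e, Cr A B e → (e ⊆ S ∨ e ⊆ V \ S) → e ∈ H

open Classical in
lemma cr_le {V A B : Finset α} {H : Finset (Finset α)} (hd : Disjoint A B) (hAB : A ∪ B = V)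
    (hc : H.card ≤ 35 ∨ TwoK V H) (ht : Tri V H) {p : α} (hp : p ∈ A) :
    (H.filter (Cr A B)).card ≤ 35 ∨ ((H.filter (Cr A B)).card = 36 ∧ ∃ S, p ∈ S ∧ Full V A B S H) := by
  rcases hc with hc | hc
  · left; exact (card_le_card (filter_subset _ _)).trans hc
  obtain ⟨S, R, hS, hR, hSR, hV, hall⟩ := hc
  wlog hpS : p ∈ S generalizing S R
  · have hmem : p ∈ S ∪ R := by rw [hV, ← hAB]; exact mem_union_left _ hp
    rw [mem_union] at hmem
    exact this R S hR hS hSR.symm (by rw [union_comm, hV]) (fun e he => (hall e he).symm)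
      (hmem.resolve_left hpS)
  have h1 := cr18 hd hS (by rw [hAB, ← hV]; exact subset_union_left)
  have h2 := cr18 hd hR (by rw [hAB, ← hV]; exact subset_union_right)
  have h3 : H.filter (Cr A B) ⊆ cr A B S ∪ cr A B R := by
    intro e he
    rw [mem_filter] at he
    rw [mem_union, mem_cr, mem_cr]
    rcases hall e he.1 with h | h
    · exact Or.inl ⟨h, he.2⟩
    · exact Or.inr ⟨h, he.2⟩
  have h4 := card_union_le (cr A B S) (cr A B R)
  have h5 := card_le_card h3
  by_cases h6 : (H.filter (Cr A B)).card ≤ 35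
  · exact Or.inl h6
  right
  refine ⟨by omega, S, hpS, (h1.2 (by omega)).1, (h1.2 (by omega)).2, ?_, ?_⟩
  · rw [← hV]; exact subset_union_left
  · have h7 : H.filter (Cr A B) = cr A B S ∪ cr A B R := eq_of_subset_of_card_le h3 (by omega)
    intro e he hh
    have : e ∈ H.filter (Cr A B) := by
      rw [h7, mem_union, mem_cr, mem_cr]
      rcases hh with h | h
      · exact Or.inl ⟨h, he⟩
      · right
        refine ⟨?_, he⟩
        rwa [← hV, union_sdiff_left, sdiff_eq_self_of_disjoint hSR.symm] at h
    exact (mem_filter.1 this).1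

lemma cr_mk {A B : Finset α} (hd : Disjoint A B) {x y z : α} (hx : x ∈ A) (hy : y ∈ B)
    (hxz : x ≠ z) (hyz : y ≠ z) : Cr A B {x, y, z} := by
  have hxy : x ≠ y := by rintro rfl; exact disjoint_left.1 hd hx hy
  refine ⟨card_eq_three.2 ⟨x, y, z, hxy, hxz, hyz, rfl⟩, fun h => ?_, fun h => ?_⟩
  · exact disjoint_left.1 hd (h (show y ∈ _ by simp)) hy
  · exact disjoint_left.1 hd hx (h (show x ∈ _ by simp))

lemma full_pair {V A B S S' : Finset α} {H H' : Finset (Finset α)} (hd : Disjoint A B)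
    (h : Full V A B S H) (h' : Full V A B S' H') (hdis : Disjoint H H') {p : α} (hpA : p ∈ A)
    (hp : p ∈ S) (hp' : p ∈ S') : Disjoint (S ∩ B) (S' ∩ B) := by
  rw [disjoint_left]
  intro b hb hb'
  rw [mem_inter] at hb hb'
  have key : ∀ t, t ∈ S → t ∈ S' → t = p ∨ t = b := by
    intro t h1 h2
    by_contra hh
    push Not at hh
    have hcr := cr_mk hd hpA hb.2 hh.1.symm hh.2.symm
    have e1 := h.all _ hcr (Or.inl (by intro z hz; simp at hz; rcases hz with rfl | rfl | rfl <;> tauto))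
    have e2 := h'.all _ hcr (Or.inl (by intro z hz; simp at hz; rcases hz with rfl | rfl | rfl <;> tauto))
    exact disjoint_left.1 hdis e1 e2
  have hbA : b ∉ A := fun k => disjoint_left.1 hd k hb.2
  have hpB : p ∉ B := fun k => disjoint_left.1 hd hpA k
  have c1 : ((S ∩ A).erase p).card = 2 := by
    rw [card_erase_of_mem (mem_inter.2 ⟨hp, hpA⟩), h.a3]
  have c2 : ((S ∩ B).erase b).card = 2 := by
    rw [card_erase_of_mem (mem_inter.2 hb), h.b3]
  obtain ⟨s, t, hst, e1⟩ := card_eq_two.1 c1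
  obtain ⟨u, v, huv, e2⟩ := card_eq_two.1 c2
  have ms : s ∈ (S ∩ A).erase p := by rw [e1]; simp
  have mt : t ∈ (S ∩ A).erase p := by rw [e1]; simp
  have mu : u ∈ (S ∩ B).erase b := by rw [e2]; simp
  rw [mem_erase, mem_inter] at ms mt mu
  have hut : u ≠ t := by rintro rfl; exact disjoint_left.1 hd mt.2.2 mu.2.2
  have hcr := cr_mk hd ms.2.2 mu.2.2 hst hut
  have f1 : ∀ z, z ∈ ({s, u, t} : Finset α) → z ∈ S ∧ z ∉ S' := by
    intro z hz
    simp only [mem_insert, mem_singleton] at hz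
    rcases hz with rfl | rfl | rfl
    · exact ⟨ms.2.1, fun k => (key _ ms.2.1 k).elim ms.1 (fun k => hbA (k ▸ ms.2.2))⟩
    · exact ⟨mu.2.1, fun k => (key _ mu.2.1 k).elim (fun k => hpB (k ▸ mu.2.2)) mu.1⟩
    · exact ⟨mt.2.1, fun k => (key _ mt.2.1 k).elim mt.1 (fun k => hbA (k ▸ mt.2.2))⟩
  have e1 := h.all _ hcr (Or.inl fun z hz => (f1 z hz).1)
  have e2 := h'.all _ hcr (Or.inr fun z hz => mem_sdiff.2 ⟨h.sub (f1 z hz).1, (f1 z hz).2⟩)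
  exact disjoint_left.1 hdis e1 e2

open Classical in
lemma NC.six (hr : NC α ι 5 3) : NC α ι 6 2 := by
  intro V I H hV hI hF
  by_contra hu
  push Not at hu
  by_cases hn : ∃ i ∈ I, Near (H i)
  · obtain ⟨i, hi, v, hv⟩ := hn
    exact absurd (near_del (m := 2) (q := 1) hr hV hI hF hi hv) (by omega)
  push Not at hn
  have hB : B V.card = 35 := by rw [hV]; decide
  have hcc : ∀ i ∈ I, (H i).card ≤ 35 ∨ TwoK V (H i) := by
    intro i hi
    rcases main_concl (by omega) (by omega) (hF.tri i hi) (hF.pf i hi) with h | h | h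
    · exact absurd h (hn i hi)
    · left; omega
    · exact Or.inr h.2
  obtain ⟨i, hi, hc⟩ := pigeon (K := 35) (by rw [hI, hV]; decide) hu
  obtain ⟨A, A', hA, hA', hd, hAB, hall⟩ := (hcc i hi).resolve_left (by omega)
  obtain ⟨p, hpA⟩ : A.Nonempty := card_pos.1 (by omega)
  have hX : 180 ≤ (cr A A' V).card := by
    have h1 := card_cr (S := V) hd
    rw [inter_eq_right.2 (hAB ▸ subset_union_left), inter_eq_right.2 (hAB ▸ subset_union_right), hV,
      hA, hA'] at h1
    have h2 : Nat.choose 6 3 = 20 := by decide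
    have h3 : Nat.choose (6 + 6) 3 = 220 := by decide
    omega
  have hsub : cr A A' V ⊆ unc V I H ∪ (I.erase i).biUnion (fun j => (H j).filter (Cr A A')) := by
    intro e he
    rw [mem_cr] at he
    by_cases hh : e ∈ unc V I H
    · exact mem_union_left _ hh
    apply mem_union_right
    simp only [unc, mem_sdiff, mem_powersetCard, not_and, not_not, mem_biUnion] at hh
    obtain ⟨j, hj, hej⟩ := hh ⟨he.1, he.2.1⟩
    rw [mem_biUnion]
    refine ⟨j, mem_erase.2 ⟨?_, hj⟩, mem_filter.2 ⟨hej, he.2⟩⟩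
    rintro rfl
    exact (hall e hej).elim he.2.2.1 he.2.2.2
  have h1 := (card_le_card hsub).trans (card_union_le _ _)
  have h2 : ((I.erase i).biUnion (fun j => (H j).filter (Cr A A'))).card ≤
      ∑ j ∈ I.erase i, ((H j).filter (Cr A A')).card := card_biUnion_le
  set J := (I.erase i).filter (fun j => ((H j).filter (Cr A A')).card = 36) with hJ
  have hle : ∀ j ∈ I.erase i, ((H j).filter (Cr A A')).card ≤ 35 +
      (if ((H j).filter (Cr A A')).card = 36 then 1 else 0) := by
    intro j hj
    rcases cr_le hd hAB (hcc j (mem_of_mem_erase hj)) (hF.tri j (mem_of_mem_erase hj)) hpA with k | k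
    · omega
    · rw [if_pos k.1, k.1]
  have h3 := sum_le_sum hle
  rw [sum_add_distrib, sum_const, ← card_filter, card_erase_of_mem hi, hI] at h3
  have hJ3 : 2 < J.card := by
    rw [smul_eq_mul] at h3
    rw [hJ]
    omega
  obtain ⟨j1, m1, j2, m2, j3, m3, n12, n13, n23⟩ := two_lt_card.1 hJ3
  have hfull : ∀ j ∈ J, ∃ S, p ∈ S ∧ Full V A A' S (H j) := by
    intro j hj
    rw [hJ, mem_filter] at hj
    have hj1 := mem_of_mem_erase hj.1
    rcases cr_le hd hAB (hcc j hj1) (hF.tri j hj1) hpA with k | k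
    · omega
    · exact k.2
  have hJI : ∀ j ∈ J, j ∈ I := fun j hj => mem_of_mem_erase (mem_filter.1 hj).1
  obtain ⟨S1, p1, f1⟩ := hfull j1 m1
  obtain ⟨S2, p2, f2⟩ := hfull j2 m2
  obtain ⟨S3, p3, f3⟩ := hfull j3 m3
  have d12 := full_pair hd f1 f2 (hF.dis _ (hJI _ m1) _ (hJI _ m2) n12) hpA p1 p2
  have d13 := full_pair hd f1 f3 (hF.dis _ (hJI _ m1) _ (hJI _ m3) n13) hpA p1 p3
  have d23 := full_pair hd f2 f3 (hF.dis _ (hJI _ m2) _ (hJI _ m3) n23) hpA p2 p3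
  have hs : (S1 ∩ A') ∪ ((S2 ∩ A') ∪ (S3 ∩ A')) ⊆ A' :=
    union_subset inter_subset_right (union_subset inter_subset_right inter_subset_right)
  have := card_le_card hs
  rw [card_union_of_disjoint (disjoint_union_right.2 ⟨d12, d13⟩), card_union_of_disjoint d23,
    f1.b3, f2.b3, f3.b3, hA'] at this
  omega

theorem NC.all {r : ℕ} (hr : r ≤ 9) : NC α ι r 0 := by
  have h0 : NC α ι 0 8 := NC.zero
  have h1 : NC α ι 1 7 := h0.step (by norm_num) (by norm_num) (by decide)
  have h2 : NC α ι 2 6 := h1.step (by norm_num) (by norm_num) (by decide)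
  have h3 : NC α ι 3 5 := h2.step (by norm_num) (by norm_num) (by decide)
  have h4 : NC α ι 4 4 := h3.step (by norm_num) (by norm_num) (by decide)
  have h5 : NC α ι 5 3 := h4.step (by norm_num) (by norm_num) (by decide)
  have h6 : NC α ι 6 2 := h5.six
  have h7 : NC α ι 7 2 := h6.seven
  have h8 : NC α ι 8 1 := h7.step (by norm_num) (by norm_num) (by decide)
  have h9 : NC α ι 9 0 := h8.step (by norm_num) (by norm_num) (by decide)
  interval_cases r
  exacts [h0.mono (by norm_num), h1.mono (by norm_num), h2.mono (by norm_num), h3.mono (by norm_num),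
    h4.mono (by norm_num), h5.mono (by norm_num), h6.mono (by norm_num), h7.mono (by norm_num),
    h8.mono (by norm_num), h9]

end LP

namespace LP
open Finset

lemma ramsey_upper {r : ℕ} (h9 : r ≤ 9) : ramseyProp (r + 6) r := by
  intro col
  set H : Fin r → Finset (Finset (Fin (r + 6))) := fun i =>
    (powersetCard 3 univ).filter (fun e => col e = i) with hH
  have ht : ∀ i ∈ (univ : Finset (Fin r)), Tri univ (H i) := by
    intro i _ e he
    rw [hH, mem_filter, mem_powersetCard] at he
    exact he.1
  by_cases hp : ∀ i ∈ (univ : Finset (Fin r)), PF (H i)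
  · exfalso
    have := NC.all (α := Fin (r + 6)) (ι := Fin r) h9 univ univ H (by simp) (by simp)
      ⟨ht, hp, fun i _ j _ hij => disjoint_left.2 fun e h1 h2 => by
        rw [hH, mem_filter] at h1 h2
        exact hij (h1.2.symm.trans h2.2)⟩
    have h0 : unc univ univ H = ∅ := by
      rw [unc, sdiff_eq_empty_iff_subset]
      intro e he
      rw [mem_biUnion]
      exact ⟨col e, mem_univ _, mem_filter.2 ⟨he, rfl⟩⟩
    rw [h0] at this
    simp at this
  · push Not at hp
    obtain ⟨i, hi, hp⟩ := hp
    unfold PF at hp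
    push Not at hp
    obtain ⟨E, hE, F, hF, G, hG, h1, h2, h3, -⟩ := hp
    have ht := ht i hi
    obtain ⟨c, hc⟩ := card_eq_one.1 h1
    obtain ⟨e, he⟩ := card_eq_one.1 h2
    have mc : c ∈ E ∩ F := by rw [hc]; simp
    have me : e ∈ F ∩ G := by rw [he]; simp
    rw [mem_inter] at mc me
    have hce : c ≠ e := by rintro rfl; exact disjoint_left.1 h3 mc.1 me.2
    obtain ⟨a, b, t1, rfl⟩ := exT_mem ht hE mc.1
    obtain ⟨d, t2, rfl⟩ := exT_mem2 ht hF mc.2 me.1 hce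
    obtain ⟨f, g, t3, rfl⟩ := exT_mem ht hG me.2
    have k1 := t1.ne ht
    have k2 := t2.ne ht
    have k3 := t3.ne ht
    have c1 : ∀ z, z ∈ ({c, a, b} : Finset (Fin (r + 6))) → z ∈ ({c, e, d} : Finset (Fin (r + 6))) → z = c :=
      fun z h h' => by
        have : z ∈ ({c, a, b} : Finset (Fin (r + 6))) ∩ {c, e, d} := mem_inter.2 ⟨h, h'⟩
        rw [hc] at this
        simpa using this
    have c2 : ∀ z, z ∈ ({c, e, d} : Finset (Fin (r + 6))) → z ∈ ({e, f, g} : Finset (Fin (r + 6))) → z = e :=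
      fun z h h' => by
        have : z ∈ ({c, e, d} : Finset (Fin (r + 6))) ∩ {e, f, g} := mem_inter.2 ⟨h, h'⟩
        rw [he] at this
        simpa using this
    have c3 : ∀ z, z ∈ ({c, a, b} : Finset (Fin (r + 6))) → z ∉ ({e, f, g} : Finset (Fin (r + 6))) :=
      fun z h => disjoint_left.1 h3 h
    simp only [mem_insert, mem_singleton] at c1 c2 c3
    have g1 := t1.rot
    have g2 := t2.s23
    have e1 := (mem_filter.1 g1).2
    have e2 := (mem_filter.1 g2).2
    have e3 := (mem_filter.1 t3).2
    refine ⟨a, b, c, d, e, f, g, ?_, e1.trans e2.symm, e2.trans e3.symm⟩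
    have ca := c3 a (by simp)
    have cb := c3 b (by simp)
    have cc := c3 c (by simp)
    have da := c1 a (by simp)
    have db := c1 b (by simp)
    have dd := c2 d (by simp)
    clear c1 c2 c3 e1 e2 e3 g1 g2 t1 t2 t3 h1 h2 h3 hc he hE hF hG mc me
    simp only [List.pairwise_cons, List.mem_cons, List.not_mem_nil, or_false, forall_eq_or_imp, forall_eq]
    grind

noncomputable def mu {n : ℕ} (s : Finset (Fin n)) : ℕ := sInf {k | ∃ x ∈ s, (x : ℕ) = k}

lemma mu_mem {n : ℕ} {s : Finset (Fin n)} (h : s.Nonempty) : ∃ x ∈ s, (x : ℕ) = mu s := by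
  obtain ⟨x, hx⟩ := h
  exact Nat.sInf_mem (s := {k | ∃ x ∈ s, (x : ℕ) = k}) ⟨x, x, hx, rfl⟩

lemma mu_le {n : ℕ} {s : Finset (Fin n)} {x : Fin n} (h : x ∈ s) : mu s ≤ x :=
  Nat.sInf_le ⟨x, h, rfl⟩

lemma ramsey_lower {n r : ℕ} (h1 : 1 ≤ r) (h : ramseyProp n r) : r + 6 ≤ n := by
  by_contra hn
  obtain ⟨a, b, c, d, e, f, g, hne, k1, k2⟩ := h (fun s => ⟨min (mu s) (r - 1), by omega⟩)
  simp only [Fin.mk.injEq] at k1 k2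
  by_cases hlt : mu ({a, b, c} : Finset (Fin n)) < r - 1
  · have e1 : mu ({a, b, c} : Finset (Fin n)) = mu ({e, f, g} : Finset (Fin n)) := by omega
    obtain ⟨x, hx, hx'⟩ := mu_mem (s := ({a, b, c} : Finset (Fin n))) (by simp)
    obtain ⟨y, hy, hy'⟩ := mu_mem (s := ({e, f, g} : Finset (Fin n))) (by simp)
    have hxy : x = y := Fin.ext (by omega)
    subst hxy
    simp only [mem_insert, mem_singleton] at hx hy
    simp only [List.pairwise_cons, List.mem_cons, List.not_mem_nil, or_false, forall_eq_or_imp, forall_eq] at hne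
    grind
  · have ha := mu_le (s := {a, b, c}) (x := a) (by simp)
    have hb := mu_le (s := {a, b, c}) (x := b) (by simp)
    have hc := mu_le (s := {a, b, c}) (x := c) (by simp)
    have hd := mu_le (s := {c, d, e}) (x := d) (by simp)
    have he := mu_le (s := {e, f, g}) (x := e) (by simp)
    have hf := mu_le (s := {e, f, g}) (x := f) (by simp)
    have hg := mu_le (s := {e, f, g}) (x := g) (by simp)
    have hnd : List.Nodup [a, b, c, d, e, f, g] := hne
    have hcard := List.toFinset_card_of_nodup hnd
    have hsub : ([a, b, c, d, e, f, g].toFinset).image (fun z : Fin n => (z : ℕ)) ⊆ Ico (r - 1) n := by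
      intro z hz
      simp only [mem_image, List.mem_toFinset, List.mem_cons, List.not_mem_nil, or_false] at hz
      obtain ⟨w, hw, rfl⟩ := hz
      rw [mem_Ico]
      refine ⟨?_, w.2⟩
      rcases hw with rfl | rfl | rfl | rfl | rfl | rfl | rfl <;> omega
    have hle := card_le_card hsub
    rw [card_image_of_injective _ Fin.val_injective, hcard, Nat.card_Ico] at hle
    simp only [List.length_cons, List.length_nil] at hle
    omega

end LP

/-- For all `1 ≤ r ≤ 9`, `R(P;r) = r + 6`. -/
theorem ramsey_loose_path_up_to_nine_colors :
    ∀ r : ℕ, 1 ≤ r → r ≤ 9 → IsLeast {n : ℕ | ramseyProp n r} (r + 6) := by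
  exact fun _ h1 h9 => ⟨LP.ramsey_upper h9, fun _ hn => LP.ramsey_lower h1 hn⟩
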